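/- arXiv:2303.07813 — 2 statements merged into one kernel-verified Lean document; each statement's English description precedes it below -/
import Mathlib

section
/- Let K be a positive real number, let m be an odd integer with m ≥ 3 and m ≥ ⌊K⌋, and let (a_N)_{N≥1} be a sequence of positive real numbers with a_N → 0 as N → ∞. Then there exist a constant C > 0 and N₀ ∈ ℕ such that for all N ≥ N₀: for every X ∈ SO(2N+1) the quantity −Λ_X'(e^{-a_N/N})/Λ_X(e^{-a_N/N}) is positive, and |(a_N/N)^K ∫_{SO(2N+1)} (−Λ_X'(e^{-a_N/N})/Λ_X(e^{-a_N/N}))^K dHaar(X) − [ 1 − K a_N + K a_N/(2N) + (K(K+1)/2) a_N² − K(K+1) a_N²/(2N) + (a_N²/N²)·K(3K−1)/24 ]| ≤ C ( N^{m+1} a_N⁴ + N^m a_N³ ). -/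
open MeasureTheory Real Filter Matrix

noncomputable section

instance matrixMeasurableSpace {m n α : Type*} [MeasurableSpace α] :
    MeasurableSpace (Matrix m n α) :=
  (inferInstance : MeasurableSpace (m → n → α))

/-- The special orthogonal group `SO(n)`, realised as the subgroup of the orthogonal group
`O(n)` consisting of matrices of determinant one. -/
def SOsub (n : ℕ) : Subgroup (Matrix.orthogonalGroup (Fin n) ℝ) where
  carrier := {X | (X : Matrix (Fin n) (Fin n) ℝ).det = 1}
  one_mem' := by simp
  mul_mem' := by
    intro a b ha hb
    simp only [Set.mem_setOf_eq] at *
    simp [Matrix.det_mul, ha, hb]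
  inv_mem' := by
    intro a ha
    simp only [Set.mem_setOf_eq] at *
    have h : ((a⁻¹ * a : Matrix.orthogonalGroup (Fin n) ℝ) : Matrix (Fin n) (Fin n) ℝ) = 1 := by
      simp
    have := congrArg Matrix.det h
    simp only [MulMemClass.coe_mul, Matrix.det_mul, ha, mul_one, Matrix.det_one] at this
    exact this

/-- The group `SO(2N+1)`. -/
abbrev SOodd (N : ℕ) := ↥(SOsub (2 * N + 1))

/-- The matrix underlying an element of `SO(2N+1)`. -/
def mat {N : ℕ} (X : SOodd N) : Matrix (Fin (2 * N + 1)) (Fin (2 * N + 1)) ℝ :=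
  ((X : Matrix.orthogonalGroup (Fin (2 * N + 1)) ℝ) : Matrix (Fin (2 * N + 1)) (Fin (2 * N + 1)) ℝ)

/-- The characteristic polynomial `Λ_X(s) = det(I - s Xᵀ)` of `X ∈ SO(2N+1)`. -/
def charPoly {N : ℕ} (X : SOodd N) (s : ℝ) : ℝ :=
  (1 - s • (mat X)ᵀ).det

section Topology

variable {N : ℕ}

instance matrixBorelSpace {m n : Type*} [Countable m] [Countable n] :
    BorelSpace (Matrix m n ℝ) :=
  (inferInstance : BorelSpace (m → n → ℝ))

instance matrixSecondCountableTopology {m n : Type*} [Countable m] [Countable n] :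
    SecondCountableTopology (Matrix m n ℝ) :=
  (inferInstance : SecondCountableTopology (m → n → ℝ))

instance SOodd.borelSpace : BorelSpace (SOodd N) :=
  (inferInstance : BorelSpace {X : Matrix.orthogonalGroup (Fin (2 * N + 1)) ℝ //
    X ∈ SOsub (2 * N + 1)})

lemma continuous_mat : Continuous (mat : SOodd N → Matrix _ _ ℝ) :=
  continuous_subtype_val.comp continuous_subtype_val

@[fun_prop]
lemma continuous_mat_apply (i j : Fin (2 * N + 1)) : Continuous fun X : SOodd N => mat X i j :=
  continuous_mat.matrix_elem i j

lemma mat_mul (X Y : SOodd N) : mat (X * Y) = mat X * mat Y := rfl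

lemma mat_mul_transpose (X : SOodd N) : mat X * (mat X)ᵀ = 1 :=
  (Matrix.mem_orthogonalGroup_iff _ _).1 X.1.2

lemma mat_transpose_mul (X : SOodd N) : (mat X)ᵀ * mat X = 1 :=
  (Matrix.mem_orthogonalGroup_iff' _ _).1 X.1.2

lemma mat_inv (X : SOodd N) : mat X⁻¹ = (mat X)ᵀ := rfl

lemma det_mat (X : SOodd N) : (mat X).det = 1 := X.2

/-- An orthogonal matrix of determinant one, as an element of `SO(2N+1)`. -/
def SOodd.mk (M : Matrix (Fin (2 * N + 1)) (Fin (2 * N + 1)) ℝ) (h : M * Mᵀ = 1)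
    (hdet : M.det = 1) : SOodd N :=
  ⟨⟨M, (Matrix.mem_orthogonalGroup_iff _ _).2 h⟩, hdet⟩

lemma mat_mk (M : Matrix (Fin (2 * N + 1)) (Fin (2 * N + 1)) ℝ) (h : M * Mᵀ = 1)
    (hdet : M.det = 1) : mat (SOodd.mk M h hdet) = M := rfl

lemma abs_mat_apply_le_one (X : SOodd N) (i j : Fin (2 * N + 1)) : |mat X i j| ≤ 1 :=
  entry_norm_bound_of_unitary X.1.2 i j

lemma sum_sq_col_mat (X : SOodd N) (j : Fin (2 * N + 1)) : ∑ i, mat X i j ^ 2 = 1 := by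
  have h := congrFun (congrFun (mat_transpose_mul X) j) j
  simpa [Matrix.mul_apply, sq] using h

lemma range_mat : Set.range (mat : SOodd N → Matrix _ _ ℝ) =
    {M | M * Mᵀ = 1 ∧ M.det = 1} := by
  ext M
  constructor
  · rintro ⟨X, rfl⟩
    exact ⟨mat_mul_transpose X, det_mat X⟩
  · rintro ⟨h, hdet⟩
    exact ⟨SOodd.mk M h hdet, rfl⟩

lemma isInducing_mat : Topology.IsInducing (mat : SOodd N → Matrix _ _ ℝ) :=
  Topology.IsInducing.subtypeVal.comp Topology.IsInducing.subtypeVal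

instance SOodd.secondCountableTopology : SecondCountableTopology (SOodd N) :=
  isInducing_mat.secondCountableTopology

instance SOodd.compactSpace : CompactSpace (SOodd N) := by
  rw [← isCompact_univ_iff, isInducing_mat.isCompact_iff, Set.image_univ]
  have hbox : IsCompact (Set.univ.pi fun _ : Fin (2 * N + 1) =>
      Set.univ.pi fun _ : Fin (2 * N + 1) => Set.Icc (-1 : ℝ) 1) :=
    isCompact_univ_pi fun _ => isCompact_univ_pi fun _ => isCompact_Icc
  refine hbox.of_isClosed_subset ?_ ?_
  · rw [range_mat]
    refine IsClosed.inter (isClosed_eq ?_ continuous_const) (isClosed_eq ?_ continuous_const)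
    · exact continuous_id.matrix_mul continuous_id.matrix_transpose
    · exact continuous_id.matrix_det
  · rintro _ ⟨X, rfl⟩ i _ j _
    exact abs_le.1 (abs_mat_apply_le_one X i j)

lemma integral_conj_eq (μ : Measure (SOodd N)) [μ.IsHaarMeasure] [IsProbabilityMeasure μ]
    (f : SOodd N → ℝ) (R : SOodd N) : ∫ X, f (R * X * R⁻¹) ∂μ = ∫ X, f X ∂μ := by
  have hc : Continuous (MulAut.conj R) := by
    change Continuous fun X => R * X * R⁻¹
    fun_prop
  have hcs : Continuous (MulAut.conj R).symm := by
    change Continuous fun X => R⁻¹ * X * R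
    fun_prop
  have hH : (μ.map (MulAut.conj R)).IsHaarMeasure := (MulAut.conj R).isHaarMeasure_map μ hc hcs
  have hP : IsProbabilityMeasure (μ.map (MulAut.conj R)) :=
    Measure.isProbabilityMeasure_map hc.aemeasurable
  have heq := Measure.isHaarMeasure_eq_of_isProbabilityMeasure (μ.map (MulAut.conj R)) μ
  let e : SOodd N ≃ₜ SOodd N := { (MulAut.conj R).toEquiv with
    continuous_toFun := hc, continuous_invFun := hcs }
  conv_rhs => rw [← heq]
  exact (e.measurableEmbedding.integral_map f).symm

end Topology

section Elements

variable {N : ℕ}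

/-- In odd dimension, the negative of a hyperplane reflection is a rotation. -/
lemma exists_mat_eq_neg_reflection (w : Fin (2 * N + 1) → ℝ) (hw : w ⬝ᵥ w ≠ 0) :
    ∃ R : SOodd N, mat R = (2 / (w ⬝ᵥ w)) • vecMulVec w w - 1 := by
  refine ⟨SOodd.mk _ ?_ ?_, rfl⟩
  · have h : vecMulVec w w * vecMulVec w w = (w ⬝ᵥ w) • vecMulVec w w := by
      rw [vecMulVec_mul_vecMulVec]
      ext i j
      simp [vecMulVec_apply]
      ring
    simp only [transpose_sub, transpose_smul, transpose_vecMulVec, transpose_one, sub_mul, mul_sub,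
      smul_mul_assoc, mul_smul_comm, h, one_mul, mul_one, smul_smul]
    rw [div_mul_cancel₀ _ hw, two_smul]
    module
  · have h : (2 / (w ⬝ᵥ w)) • vecMulVec w w - 1 =
        -(1 + replicateCol Unit (-(2 / (w ⬝ᵥ w)) • w) * replicateRow Unit w) := by
      rw [← vecMulVec_eq]
      ext i j
      simp [vecMulVec_apply]
      ring
    rw [h, det_neg, det_one_add_replicateCol_mul_replicateRow, dotProduct_smul]
    simp [pow_add, pow_mul]
    field_simp
    ring

/-- The quadratic form of `X` at `x` is, up to the factor `x ⬝ᵥ x`, a diagonal entry of a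
conjugate of `X`. -/
lemma exists_conj_dotProduct_mulVec (x : Fin (2 * N + 1) → ℝ) :
    ∃ R : SOodd N, ∀ X : SOodd N,
      x ⬝ᵥ (mat X *ᵥ x) = (x ⬝ᵥ x) * mat (R * X * R⁻¹) 0 0 := by
  set r := √(x ⬝ᵥ x) with hr
  have hr2 : r * r = x ⬝ᵥ x := Real.mul_self_sqrt (dotProduct_self_star_nonneg x)
  obtain ⟨R, hR⟩ : ∃ R : SOodd N, x = r • (mat R *ᵥ Pi.single 0 1) ∨
      x = -(r • (mat R *ᵥ Pi.single 0 1)) := by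
    set w : Fin (2 * N + 1) → ℝ := r • Pi.single 0 1 - x with hwdef
    by_cases hw : w ⬝ᵥ w = 0
    · refine ⟨1, Or.inl ?_⟩
      have h0 : w = 0 := dotProduct_self_eq_zero.1 hw
      have : mat (1 : SOodd N) = 1 := rfl
      rw [this, one_mulVec]
      exact (sub_eq_zero.1 h0).symm
    · obtain ⟨R, hR⟩ := exists_mat_eq_neg_reflection w hw
      refine ⟨R, Or.inr ?_⟩
      have hww : w ⬝ᵥ w = 2 * r * w 0 := by
        simp only [hwdef, sub_dotProduct, dotProduct_sub, smul_dotProduct, dotProduct_smul,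
          ← hr2, single_one_dotProduct, dotProduct_single_one]
        simp
        ring
      have h1 : r • (mat R *ᵥ Pi.single 0 1) = w - r • Pi.single 0 1 := by
        have e : r * (2 / (w ⬝ᵥ w) * w 0) = 1 := by
          rw [hww] at hw ⊢
          have h2 : r * w 0 ≠ 0 := fun h => hw (by rw [mul_assoc, h, mul_zero])
          field_simp
          exact div_self h2
        ext i
        have : mat R i 0 = 2 / (w ⬝ᵥ w) * (w i * w 0) -
            (1 : Matrix (Fin (2 * N + 1)) (Fin (2 * N + 1)) ℝ) i 0 := by
          rw [hR]; simp [vecMulVec_apply]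
        simp only [mulVec_single_one, Pi.smul_apply, col_apply, this, smul_eq_mul, Pi.sub_apply,
          Matrix.one_apply, Pi.single_apply]
        linear_combination (w i) * e
      rw [h1, hwdef]
      module
  have key : ∀ X : SOodd N, (mat R *ᵥ Pi.single 0 1) ⬝ᵥ (mat X *ᵥ (mat R *ᵥ Pi.single 0 1)) =
      mat (R⁻¹ * X * R⁻¹⁻¹) 0 0 := by
    intro X
    rw [mat_mul, mat_mul, inv_inv, mat_inv, mulVec_mulVec, dotProduct_mulVec, vecMul_mulVec]
    simp [mul_assoc]
  refine ⟨R⁻¹, fun X => ?_⟩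
  rw [← key, ← hr2]
  rcases hR with h | h
  · conv_lhs => rw [h]
    simp [mulVec_smul, mul_assoc]
  · conv_lhs => rw [h]
    simp [mulVec_smul, mulVec_neg, mul_assoc]

end Elements

section CompactIntegrals

variable {G : Type*} [TopologicalSpace G] [CompactSpace G] [MeasurableSpace G]
  [OpensMeasurableSpace G] {μ : Measure G} [IsFiniteMeasure μ]

lemma Continuous.integrable_of_compactSpace {f : G → ℝ} (hf : Continuous f) : Integrable f μ :=
  hf.integrable_of_hasCompactSupport (HasCompactSupport.of_compactSpace f)

/-- Differentiation under the integral sign over a compact space. -/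
lemma hasDerivAt_integral_of_compactSpace {U : Set ℝ} (hU : IsOpen U) {F F' : ℝ → G → ℝ}
    (hF : ∀ s ∈ U, Continuous (F s))
    (hF' : ContinuousOn (Function.uncurry F') (U ×ˢ Set.univ))
    (hd : ∀ s ∈ U, ∀ x, HasDerivAt (fun s => F s x) (F' s x) s) {s₀ : ℝ} (hs₀ : s₀ ∈ U) :
    HasDerivAt (fun s => ∫ x, F s x ∂μ) (∫ x, F' s₀ x ∂μ) s₀ := by
  obtain ⟨ε, hε, hball⟩ := Metric.nhds_basis_closedBall.mem_iff.1 (hU.mem_nhds hs₀)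
  have hK : IsCompact (Metric.closedBall s₀ ε ×ˢ (Set.univ : Set G)) :=
    (isCompact_closedBall s₀ ε).prod isCompact_univ
  obtain ⟨C, hC⟩ := hK.exists_bound_of_continuousOn
    (hF'.mono (Set.prod_mono hball subset_rfl))
  have hc' : Continuous (F' s₀) := by
    have := hF'.comp_continuous (f := fun x : G => (s₀, x)) (by fun_prop) (fun x => ⟨hs₀, trivial⟩)
    exact this
  refine (hasDerivAt_integral_of_dominated_loc_of_deriv_le (bound := fun _ => C)
    (Metric.closedBall_mem_nhds s₀ hε) ?_ (hF s₀ hs₀).integrable_of_compactSpace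
    hc'.integrable_of_compactSpace.aestronglyMeasurable ?_ (integrable_const C) ?_).2
  · filter_upwards [hU.mem_nhds hs₀] with s hs
    exact (hF s hs).integrable_of_compactSpace.aestronglyMeasurable
  · exact Eventually.of_forall fun x s hs => hC (s, x) ⟨hs, trivial⟩
  · exact Eventually.of_forall fun x s hs => hd s (hball hs) x

end CompactIntegrals

section SignAverage

variable {N : ℕ}

lemma det_sum_rows {n : Type*} [Fintype n] [DecidableEq n] (g : n → Bool → n → ℝ) :
    (of fun i j => ∑ b, g i b j).det = ∑ r : n → Bool, (of fun i j => g i (r i) j).det := by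
  have h := MultilinearMap.map_sum (Matrix.detRowAlternating (R := ℝ) (n := n)).toMultilinearMap
    (α := fun _ => Bool) g
  refine Eq.trans ?_ h
  change _ = Matrix.det _
  congr 1

/-- The sign attached to a boolean at the index `i`; at `0` it is always positive. -/
def rowSign (i : Fin (2 * N + 1)) (b : Bool) : ℝ :=
  if i = 0 then 1 else if b then 1 else -1

lemma rowSign_mul_self (i : Fin (2 * N + 1)) (b : Bool) : rowSign i b * rowSign i b = 1 := by
  unfold rowSign; split_ifs <;> norm_num

lemma prod_rowSign_eq (r : Fin (2 * N + 1) → Bool) :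
    ∏ i, rowSign i (r i) = 1 ∨ ∏ i, rowSign i (r i) = -1 := by
  rw [← mul_self_eq_one_iff, ← Finset.prod_mul_distrib]
  simp [rowSign_mul_self]

lemma sum_prod_mul_det (q : Fin (2 * N + 1) → Bool → ℝ)
    (M : Matrix (Fin (2 * N + 1)) (Fin (2 * N + 1)) ℝ) (t : ℝ) :
    ∑ r : Fin (2 * N + 1) → Bool, (∏ i, q i (r i)) *
      (1 - t • (diagonal (fun i => rowSign i (r i)) * M)).det =
    (of fun i j => ∑ b, q i b * ((1 : Matrix _ _ ℝ) i j - t * (rowSign i b * M i j))).det := by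
  rw [det_sum_rows]
  refine Finset.sum_congr rfl fun r _ => ?_
  rw [← det_mul_column]
  congr 1
  ext i j
  simp [diagonal_mul]

lemma sum_rowSign_mul_det (M : Matrix (Fin (2 * N + 1)) (Fin (2 * N + 1)) ℝ) (t : ℝ) :
    ∑ r : Fin (2 * N + 1) → Bool, (1 + ∏ i, rowSign i (r i)) / 2 ^ (2 * N + 1) *
      (1 - t • (diagonal (fun i => rowSign i (r i)) * M)).det =
    1 - t * M 0 0 + (t ^ (2 * N) * M.adjugate 0 0 - t ^ (2 * N + 1) * M.det) := by
  have h1 := sum_prod_mul_det (fun _ _ => 1 / 2) M t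
  have h2 := sum_prod_mul_det (fun i b => rowSign i b / 2) M t
  have e1 : (of fun i j => ∑ b, 1 / 2 * ((1 : Matrix _ _ ℝ) i j - t * (rowSign i b * M i j))) =
      1 + replicateCol Unit (Pi.single (0 : Fin (2 * N + 1)) (1 : ℝ)) *
        replicateRow Unit (-t • M 0) := by
    rw [← vecMulVec_eq]
    ext i j
    by_cases hi : i = 0
    · subst hi
      simp [rowSign, vecMulVec_apply]
      ring
    · simp [rowSign, vecMulVec_apply, hi]
      ring
  have e2 : (of fun i j => ∑ b, rowSign i b / 2 *
      ((1 : Matrix _ _ ℝ) i j - t * (rowSign i b * M i j))) =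
      updateRow (-t • M) 0 (Pi.single 0 1 + (-t • M) 0) := by
    ext i j
    by_cases hi : i = 0
    · subst hi
      simp [rowSign, Matrix.one_apply, Pi.single_apply, eq_comm]
      ring
    · simp [rowSign, hi]
      ring
  rw [e1, det_one_add_replicateCol_mul_replicateRow] at h1
  rw [e2, det_updateRow_add, updateRow_eq_self, ← adjugate_apply, adjugate_smul, det_smul] at h2
  simp only [add_div, add_mul, Finset.sum_add_distrib]
  refine congrArg₂ (· + ·) ?_ ?_
  · simpa [sub_eq_add_neg] using h1
  · simp only [Finset.prod_div_distrib, Finset.prod_const, Finset.card_univ, Fintype.card_fin] at h2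
    rw [h2]
    simp [pow_add, pow_mul]
    ring

lemma charPoly_eq (X : SOodd N) (t : ℝ) : charPoly X t = (1 - t • mat X).det := by
  rw [charPoly, ← det_transpose]
  simp

lemma adjugate_mat (X : SOodd N) : (mat X).adjugate = (mat X)ᵀ := by
  have h := congrArg (fun Y => Y * (mat X)ᵀ) (adjugate_mul (mat X))
  simpa [mul_assoc, mat_mul_transpose, det_mat] using h

/-- Averaging the characteristic polynomial over diagonal sign matrices fixing the first
coordinate. -/
lemma exists_sign_average (N : ℕ) : ∃ (w : (Fin (2 * N + 1) → Bool) → ℝ)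
    (D : (Fin (2 * N + 1) → Bool) → SOodd N),
    (∀ r X, mat (D r * X) 0 0 = mat X 0 0) ∧
    ∀ X t, ∑ r, w r * charPoly (D r * X) t =
      1 - t * mat X 0 0 + (t ^ (2 * N) * mat X 0 0 - t ^ (2 * N + 1)) := by
  classical
  have hD : ∀ r : Fin (2 * N + 1) → Bool, ∃ D : SOodd N, ∀ X, mat (D * X) 0 0 = mat X 0 0 ∧
      ∀ t, (1 + ∏ i, rowSign i (r i)) / 2 ^ (2 * N + 1) * charPoly (D * X) t =
        (1 + ∏ i, rowSign i (r i)) / 2 ^ (2 * N + 1) *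
        (1 - t • (diagonal (fun i => rowSign i (r i)) * mat X)).det := by
    intro r
    rcases prod_rowSign_eq r with h | h
    · refine ⟨SOodd.mk (diagonal fun i => rowSign i (r i)) ?_ (by rw [det_diagonal, h]),
        fun X => ⟨?_, fun t => ?_⟩⟩
      · simp [rowSign_mul_self]
      · simp [mat_mul, mat_mk, diagonal_mul, rowSign]
      · rw [charPoly_eq, mat_mul, mat_mk]
    · exact ⟨1, fun X => by simp [h]⟩
  choose D hD using hD
  refine ⟨fun r => (1 + ∏ i, rowSign i (r i)) / 2 ^ (2 * N + 1), D, fun r X => (hD r X).1,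
    fun X t => ?_⟩
  simp_rw [fun r => (hD r X).2 t, sum_rowSign_mul_det, adjugate_mat, det_mat, transpose_apply,
    mul_one]

end SignAverage

section CharPoly

variable {N : ℕ}

lemma continuous_charPoly (t : ℝ) : Continuous fun X : SOodd N => charPoly X t := by
  have h : Continuous fun X : SOodd N => (1 - t • (mat X)ᵀ) :=
    continuous_const.sub (continuous_mat.matrix_transpose.const_smul t)
  exact h.matrix_det

lemma hasDerivAt_charPoly (X : SOodd N) (t : ℝ) : HasDerivAt (charPoly X)
    (∑ σ : Equiv.Perm (Fin (2 * N + 1)), (Equiv.Perm.sign σ : ℝ) *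
      ∑ i, (∏ j ∈ Finset.univ.erase i, ((1 : Matrix _ _ ℝ) (σ j) j - t * mat X (σ j) j)) *
        (-mat X (σ i) i)) t := by
  have h : charPoly X = fun t => ∑ σ : Equiv.Perm (Fin (2 * N + 1)), (Equiv.Perm.sign σ : ℝ) *
      ∏ i, ((1 : Matrix _ _ ℝ) (σ i) i - t * mat X (σ i) i) := by
    funext t
    rw [charPoly_eq, det_apply']
    simp
  rw [h]
  refine HasDerivAt.fun_sum fun σ _ => HasDerivAt.const_mul _ ?_
  refine (HasDerivAt.fun_finsetProd (f' := fun i => -mat X (σ i) i) fun i _ => ?_).congr_deriv ?_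
  · simpa using ((hasDerivAt_id t).mul_const (mat X (σ i) i)).const_sub
      ((1 : Matrix _ _ ℝ) (σ i) i)
  · simp

lemma differentiable_charPoly (X : SOodd N) : Differentiable ℝ (charPoly X) :=
  fun t => (hasDerivAt_charPoly X t).differentiableAt

lemma continuous_deriv_charPoly (t : ℝ) :
    Continuous fun X : SOodd N => deriv (charPoly X) t := by
  simp_rw [fun X : SOodd N => (hasDerivAt_charPoly X t).deriv]
  fun_prop

lemma charPoly_conj (R X : SOodd N) : charPoly (R * X * R⁻¹) = charPoly X := by
  funext t
  have h : 1 - t • mat (R * X * R⁻¹) = mat R * (1 - t • mat X) * (mat R)ᵀ := by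
    rw [mat_mul, mat_mul, mat_inv, mul_sub, sub_mul, mul_one, mat_mul_transpose]
    simp
  rw [charPoly_eq, charPoly_eq, h, det_mul, det_mul, det_transpose, det_mat]
  ring

variable (μ : Measure (SOodd N)) [μ.IsHaarMeasure] [IsProbabilityMeasure μ]

lemma integral_mul_of_sum_translates {ι : Type*} [Fintype ι] (w : ι → ℝ) (D : ι → SOodd N)
    (hw : ∑ r, w r = 1)
    {T P φ : SOodd N → ℝ} (hT : Continuous T) (hφ : Continuous φ)
    (hφD : ∀ r X, φ (D r * X) = φ X) (hTP : ∀ X, ∑ r, w r * T (D r * X) = P X) :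
    ∫ X, T X * φ X ∂μ = ∫ X, P X * φ X ∂μ := by
  have hr : ∀ r, ∫ X, w r * T (D r * X) * φ X ∂μ = w r * ∫ X, T X * φ X ∂μ := by
    intro r
    rw [← integral_mul_left_eq_self (fun X => T X * φ X) (D r), ← integral_const_mul]
    simp_rw [hφD, mul_assoc]
  simp_rw [← hTP, Finset.sum_mul]
  rw [integral_finsetSum _ fun r _ => ?_]
  · simp_rw [hr]
    rw [← Finset.sum_mul, hw, one_mul]
  · exact Continuous.integrable_of_compactSpace (by fun_prop)

lemma sum_weight_eq_one (hN : N ≠ 0) {ι : Type*} [Fintype ι] {w : ι → ℝ} {D : ι → SOodd N}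
    (h : ∀ X t, ∑ r, w r * charPoly (D r * X) t =
      1 - t * mat X 0 0 + (t ^ (2 * N) * mat X 0 0 - t ^ (2 * N + 1))) : ∑ r, w r = 1 := by
  have := h 1 0
  simpa [charPoly, hN] using this

lemma integral_charPoly_mul (hN : N ≠ 0) {φ : ℝ → ℝ}
    (hφ : Continuous fun X : SOodd N => φ (mat X 0 0))
    (t : ℝ) : ∫ X, charPoly X t * φ (mat X 0 0) ∂μ =
      ∫ X, (1 - t * mat X 0 0 + (t ^ (2 * N) * mat X 0 0 - t ^ (2 * N + 1))) *
        φ (mat X 0 0) ∂μ := by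
  obtain ⟨w, D, hD, h⟩ := exists_sign_average N
  exact integral_mul_of_sum_translates μ w D (sum_weight_eq_one hN h) (continuous_charPoly t) hφ
    (fun r X => by simp only [hD]) (fun X => h X t)

lemma integral_deriv_charPoly_mul (hN : N ≠ 0) {φ : ℝ → ℝ}
    (hφ : Continuous fun X : SOodd N => φ (mat X 0 0))
    (t : ℝ) : ∫ X, deriv (charPoly X) t * φ (mat X 0 0) ∂μ =
      ∫ X, (-mat X 0 0 + (2 * N * t ^ (2 * N - 1) * mat X 0 0 - (2 * N + 1) * t ^ (2 * N))) *
        φ (mat X 0 0) ∂μ := by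
  obtain ⟨w, D, hD, h⟩ := exists_sign_average N
  refine integral_mul_of_sum_translates μ w D (sum_weight_eq_one hN h)
    (continuous_deriv_charPoly t) hφ (fun r X => by simp only [hD]) (fun X => ?_)
  have hl : HasDerivAt (fun t => ∑ r, w r * charPoly (D r * X) t)
      (∑ r, w r * deriv (charPoly (D r * X)) t) t :=
    HasDerivAt.fun_sum fun r _ => (differentiable_charPoly _ t).hasDerivAt.const_mul _
  have hr : HasDerivAt (fun t => 1 - t * mat X 0 0 + (t ^ (2 * N) * mat X 0 0 - t ^ (2 * N + 1)))
      (-mat X 0 0 + (2 * N * t ^ (2 * N - 1) * mat X 0 0 - (2 * N + 1) * t ^ (2 * N))) t := by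
    have h1 := ((hasDerivAt_id t).mul_const (mat X 0 0)).const_sub 1
    have h2 := ((hasDerivAt_pow (2 * N) t).mul_const (mat X 0 0)).sub
      (hasDerivAt_pow (2 * N + 1) t)
    refine (h1.add h2).congr_deriv ?_
    push_cast
    simp
  simp_rw [h X] at hl
  exact hl.unique hr

end CharPoly

section FluxLaw

variable {N : ℕ} (μ : Measure (SOodd N)) [μ.IsHaarMeasure] [IsProbabilityMeasure μ]

lemma exists_rotation (k : Fin (2 * N + 1)) (hk : k ≠ 0) (θ : ℝ) : ∃ R : SOodd N,
    ∀ X, mat (R * X) 0 0 = cos θ * mat X 0 0 + sin θ * mat X k 0 ∧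
      mat (R * X) k 0 = sin θ * mat X 0 0 - cos θ * mat X k 0 := by
  set w : Fin (2 * N + 1) → ℝ := Pi.single 0 (cos (θ / 2)) + Pi.single k (sin (θ / 2)) with hw
  have hw0 : w 0 = cos (θ / 2) := by simp [hw, hk.symm]
  have hwk : w k = sin (θ / 2) := by simp [hw, hk]
  have hdot : ∀ v : Fin (2 * N + 1) → ℝ, w ⬝ᵥ v = cos (θ / 2) * v 0 + sin (θ / 2) * v k := by
    intro v
    simp [hw, add_dotProduct]
  have hww : w ⬝ᵥ w = 1 := by
    rw [hdot, hw0, hwk, ← sq, ← sq, cos_sq_add_sin_sq]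
  obtain ⟨R, hR⟩ := exists_mat_eq_neg_reflection w (by rw [hww]; exact one_ne_zero)
  have hentry : ∀ (X : SOodd N) i, mat (R * X) i 0 =
      2 * w i * (cos (θ / 2) * mat X 0 0 + sin (θ / 2) * mat X k 0) - mat X i 0 := by
    intro X i
    rw [mat_mul, hR, hww, sub_mul, one_mul, smul_mul_assoc, Matrix.sub_apply, Matrix.smul_apply,
      vecMulVec_mul, vecMulVec_apply]
    have : (w ᵥ* mat X) 0 = w ⬝ᵥ fun i => mat X i 0 := rfl
    rw [this, hdot]
    simp
    ring
  have hc : cos θ = 2 * cos (θ / 2) ^ 2 - 1 := by rw [← cos_two_mul]; ring_nf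
  have hs : sin θ = 2 * sin (θ / 2) * cos (θ / 2) := by rw [← sin_two_mul]; ring_nf
  have h1 := sin_sq_add_cos_sq (θ / 2)
  refine ⟨R, fun X => ⟨?_, ?_⟩⟩
  · rw [hentry, hw0, hc, hs]
    ring
  · rw [hentry, hwk, hc, hs]
    linear_combination 2 * mat X k 0 * h1

/-- Integration by parts on `SO(2N+1)` in the plane spanned by two coordinate vectors. -/
lemma integral_apply_mul_eq {g g' : ℝ → ℝ} (hg : ∀ y ∈ Set.Icc (-1 : ℝ) 1, HasDerivAt g (g' y) y)
    (hg' : ContinuousOn g' (Set.Icc (-1 : ℝ) 1)) (k : Fin (2 * N + 1)) (hk : k ≠ 0) :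
    ∫ X, mat X 0 0 * g (mat X 0 0) ∂μ = ∫ X, mat X k 0 ^ 2 * g' (mat X 0 0) ∂μ := by
  have hgc : ContinuousOn g (Set.Icc (-1 : ℝ) 1) := fun y hy =>
    (hg y hy).continuousAt.continuousWithinAt
  have hmem : ∀ p : ℝ × SOodd N,
      cos p.1 * mat p.2 0 0 + sin p.1 * mat p.2 k 0 ∈ Set.Icc (-1 : ℝ) 1 := by
    rintro ⟨θ, X⟩
    obtain ⟨R, hR⟩ := exists_rotation k hk θ
    rw [← (hR X).1]
    exact abs_le.1 (abs_mat_apply_le_one _ _ _)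
  have hcc : Continuous fun p : ℝ × SOodd N => cos p.1 * mat p.2 0 0 + sin p.1 * mat p.2 k 0 := by
    have h0 := (continuous_mat_apply (N := N) 0 0).comp (continuous_snd (X := ℝ))
    have h1 := (continuous_mat_apply (N := N) k 0).comp (continuous_snd (X := ℝ))
    simp only [Function.comp_def] at h0 h1
    fun_prop
  have hss : Continuous fun p : ℝ × SOodd N => sin p.1 * mat p.2 0 0 - cos p.1 * mat p.2 k 0 := by
    have h0 := (continuous_mat_apply (N := N) 0 0).comp (continuous_snd (X := ℝ))
    have h1 := (continuous_mat_apply (N := N) k 0).comp (continuous_snd (X := ℝ))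
    simp only [Function.comp_def] at h0 h1
    fun_prop
  have hgp := hgc.comp_continuous hcc hmem
  have hgp' := hg'.comp_continuous hcc hmem
  let F : ℝ → SOodd N → ℝ := fun θ X => (sin θ * mat X 0 0 - cos θ * mat X k 0) *
    g (cos θ * mat X 0 0 + sin θ * mat X k 0)
  let F' : ℝ → SOodd N → ℝ := fun θ X => (cos θ * mat X 0 0 + sin θ * mat X k 0) *
    g (cos θ * mat X 0 0 + sin θ * mat X k 0) +
    (sin θ * mat X 0 0 - cos θ * mat X k 0) * (g' (cos θ * mat X 0 0 + sin θ * mat X k 0) *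
      -(sin θ * mat X 0 0 - cos θ * mat X k 0))
  have hFc : Continuous (Function.uncurry F) := hss.mul hgp
  have hF'c : Continuous (Function.uncurry F') :=
    (hcc.mul hgp).add (hss.mul (hgp'.mul hss.neg))
  have hd : ∀ θ X, HasDerivAt (fun θ => F θ X) (F' θ X) θ := by
    intro θ X
    have h1 : HasDerivAt (fun θ => sin θ * mat X 0 0 - cos θ * mat X k 0)
        (cos θ * mat X 0 0 + sin θ * mat X k 0) θ :=
      (((hasDerivAt_sin θ).mul_const _).sub ((hasDerivAt_cos θ).mul_const _)).congr_deriv (by ring)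
    have h2 : HasDerivAt (fun θ => cos θ * mat X 0 0 + sin θ * mat X k 0)
        (-(sin θ * mat X 0 0 - cos θ * mat X k 0)) θ :=
      (((hasDerivAt_cos θ).mul_const _).add ((hasDerivAt_sin θ).mul_const _)).congr_deriv (by ring)
    exact h1.mul ((hg _ (hmem (θ, X))).comp θ h2)
  have hder : HasDerivAt (fun θ => ∫ X, F θ X ∂μ) (∫ X, F' 0 X ∂μ) 0 :=
    hasDerivAt_integral_of_compactSpace isOpen_univ
      (fun θ _ => hFc.comp (Continuous.prodMk_right θ)) hF'c.continuousOn
    (fun θ _ X => hd θ X) (Set.mem_univ 0)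
  have hconst : ∀ θ, ∫ X, F θ X ∂μ = ∫ X, mat X k 0 * g (mat X 0 0) ∂μ := by
    intro θ
    obtain ⟨R, hR⟩ := exists_rotation k hk θ
    rw [← integral_mul_left_eq_self (fun X => mat X k 0 * g (mat X 0 0)) R]
    refine integral_congr_ae (Eventually.of_forall fun X => ?_)
    simp only [F, (hR X).1, (hR X).2]
  rw [funext hconst] at hder
  have hz := hder.unique (hasDerivAt_const (0 : ℝ) (∫ X, mat X k 0 * g (mat X 0 0) ∂μ))
  have h0 : ∀ X : SOodd N, F' 0 X = mat X 0 0 * g (mat X 0 0) - mat X k 0 ^ 2 * g' (mat X 0 0) := by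
    intro X
    simp only [F', cos_zero, sin_zero]
    ring_nf
  have hm0 : ∀ X : SOodd N, mat X 0 0 ∈ Set.Icc (-1 : ℝ) 1 := fun X =>
    abs_le.1 (abs_mat_apply_le_one _ _ _)
  have hi1 := hgc.comp_continuous (continuous_mat_apply (N := N) 0 0) hm0
  have hi2 := hg'.comp_continuous (continuous_mat_apply (N := N) 0 0) hm0
  simp_rw [h0] at hz
  rw [integral_sub] at hz
  · linarith
  · exact ((continuous_mat_apply 0 0).mul hi1).integrable_of_compactSpace
  · exact (((continuous_mat_apply k 0).pow 2).mul hi2).integrable_of_compactSpace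

lemma integral_entry_mul_eq {g g' : ℝ → ℝ} (hg : ∀ y ∈ Set.Icc (-1 : ℝ) 1, HasDerivAt g (g' y) y)
    (hg' : ContinuousOn g' (Set.Icc (-1 : ℝ) 1)) :
    2 * N * ∫ X, mat X 0 0 * g (mat X 0 0) ∂μ =
      ∫ X, (1 - mat X 0 0 ^ 2) * g' (mat X 0 0) ∂μ := by
  have hm0 : ∀ X : SOodd N, mat X 0 0 ∈ Set.Icc (-1 : ℝ) 1 := fun X =>
    abs_le.1 (abs_mat_apply_le_one _ _ _)
  have hi2 := hg'.comp_continuous (continuous_mat_apply (N := N) 0 0) hm0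
  have hsum : ∀ X : SOodd N, (1 - mat X 0 0 ^ 2) * g' (mat X 0 0) =
      ∑ i : Fin (2 * N), mat X i.succ 0 ^ 2 * g' (mat X 0 0) := by
    intro X
    rw [← sum_sq_col_mat X 0, Fin.sum_univ_succ, ← Finset.sum_mul]
    ring
  simp_rw [hsum]
  rw [integral_finsetSum]
  · simp_rw [← fun i : Fin (2 * N) =>
      integral_apply_mul_eq μ hg hg' i.succ (Fin.succ_ne_zero i)]
    simp
  · intro i _
    exact (((continuous_mat_apply i.succ 0).pow 2).mul hi2).integrable_of_compactSpace

lemma one_add_sq_sub_pos {s c : ℝ} (hs : |s| < 1) (hc : |c| ≤ 1) : 0 < 1 + s ^ 2 - 2 * s * c := by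
  have h1 : |s * c| ≤ |s| := by
    rw [abs_mul]
    exact mul_le_of_le_one_right (abs_nonneg s) hc
  have h2 := (abs_le.1 h1).2
  have h3 : 0 < (1 - |s|) ^ 2 := by
    have : 0 < 1 - |s| := by linarith
    positivity
  have := sq_abs s
  nlinarith

lemma hasDerivAt_poisson {s c p : ℝ} (hQ : 0 < 1 + s ^ 2 - 2 * s * c) :
    HasDerivAt (fun s => (1 - s * c) * (1 + s ^ 2 - 2 * s * c) ^ (-p))
      (-c * (1 + s ^ 2 - 2 * s * c) ^ (-p) +
        (1 - s * c) * (-p * (2 * s - 2 * c) * (1 + s ^ 2 - 2 * s * c) ^ (-p - 1))) s := by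
  have h1 : HasDerivAt (fun s : ℝ => 1 - s * c) (-c) s := by
    simpa using ((hasDerivAt_id s).mul_const c).const_sub 1
  have h2 : HasDerivAt (fun s : ℝ => 1 + s ^ 2 - 2 * s * c) (2 * s - 2 * c) s := by
    refine (((hasDerivAt_pow 2 s).const_add 1).sub
      (((hasDerivAt_id s).const_mul 2).mul_const c)).congr_deriv ?_
    simp
  refine (h1.mul (h2.rpow_const (p := -p) (Or.inl hQ.ne'))).congr_deriv ?_
  ring

lemma continuousOn_poisson (p : ℝ) : ContinuousOn (fun q : ℝ × SOodd N =>
    (1 + q.1 ^ 2 - 2 * q.1 * mat q.2 0 0) ^ p) (Set.Ioo (-1 : ℝ) 1 ×ˢ Set.univ) := by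
  have h0 := (continuous_mat_apply (N := N) 0 0).comp (continuous_snd (X := ℝ))
  simp only [Function.comp_def] at h0
  refine ContinuousOn.rpow_const (by fun_prop) fun q hq => Or.inl ?_
  exact (one_add_sq_sub_pos (abs_lt.2 hq.1) (abs_mat_apply_le_one _ _ _)).ne'

lemma continuous_poisson {s : ℝ} (hs : |s| < 1) (p : ℝ) :
    Continuous fun X : SOodd N => (1 + s ^ 2 - 2 * s * mat X 0 0) ^ p :=
  (continuousOn_poisson p).comp_continuous (f := fun X : SOodd N => (s, X)) (by fun_prop)
    fun _ => ⟨abs_lt.1 hs, trivial⟩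

/-- Gauss's law: the flux of the Newtonian field through the unit sphere does not depend on the
position of the charge inside the ball. -/
lemma integral_flux_eq_one {s : ℝ} (hs : |s| < 1) :
    ∫ X, (1 - s * mat X 0 0) *
      (1 + s ^ 2 - 2 * s * mat X 0 0) ^ (-((2 * N + 1 : ℝ) / 2)) ∂μ = 1 := by
  set p : ℝ := (2 * N + 1 : ℝ) / 2 with hp
  have hmem : ∀ X : SOodd N, |mat X 0 0| ≤ 1 := fun X => abs_mat_apply_le_one _ _ _
  have hder : ∀ s ∈ Set.Ioo (-1 : ℝ) 1, HasDerivAt (fun s => ∫ X, (1 - s * mat X 0 0) *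
      (1 + s ^ 2 - 2 * s * mat X 0 0) ^ (-p) ∂μ) 0 s := by
    intro s hs
    have hs' := abs_lt.2 hs
    have h0 := (continuous_mat_apply (N := N) 0 0).comp (continuous_snd (X := ℝ))
    simp only [Function.comp_def] at h0
    have h := hasDerivAt_integral_of_compactSpace (μ := μ) (isOpen_Ioo (a := (-1 : ℝ)) (b := 1))
      (F := fun s X => (1 - s * mat X 0 0) * (1 + s ^ 2 - 2 * s * mat X 0 0) ^ (-p))
      (F' := fun s X => -mat X 0 0 * (1 + s ^ 2 - 2 * s * mat X 0 0) ^ (-p) +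
        (1 - s * mat X 0 0) * (-p * (2 * s - 2 * mat X 0 0) *
          (1 + s ^ 2 - 2 * s * mat X 0 0) ^ (-p - 1)))
      (fun s hs => (by fun_prop : Continuous fun X : SOodd N => 1 - s * mat X 0 0).mul
        (continuous_poisson (abs_lt.2 hs) (-p)))
      ?_ (fun s hs X => hasDerivAt_poisson (one_add_sq_sub_pos (abs_lt.2 hs) (hmem X))) hs
    · refine h.congr_deriv ?_
      have hg : ∀ y ∈ Set.Icc (-1 : ℝ) 1, HasDerivAt (fun y => (1 + s ^ 2 - 2 * s * y) ^ (-p))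
          (2 * s * p * (1 + s ^ 2 - 2 * s * y) ^ (-p - 1)) y := by
        intro y hy
        have hl : HasDerivAt (fun y => 1 + s ^ 2 - 2 * s * y) (-(2 * s)) y := by
          simpa using ((hasDerivAt_id y).const_mul (2 * s)).const_sub (1 + s ^ 2)
        refine (hl.rpow_const (p := -p)
          (Or.inl (one_add_sq_sub_pos hs' (abs_le.2 hy)).ne')).congr_deriv ?_
        ring
      have hg' : ContinuousOn (fun y => 2 * s * p * (1 + s ^ 2 - 2 * s * y) ^ (-p - 1))
          (Set.Icc (-1 : ℝ) 1) := by
        refine continuousOn_const.mul (ContinuousOn.rpow_const (by fun_prop) fun y hy => Or.inl ?_)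
        exact (one_add_sq_sub_pos hs' (abs_le.2 hy)).ne'
      have hibp := integral_entry_mul_eq μ hg hg'
      rw [← integral_const_mul] at hibp
      have hrw : ∀ X : SOodd N, -mat X 0 0 * (1 + s ^ 2 - 2 * s * mat X 0 0) ^ (-p) +
          (1 - s * mat X 0 0) * (-p * (2 * s - 2 * mat X 0 0) *
          (1 + s ^ 2 - 2 * s * mat X 0 0) ^ (-p - 1)) =
          2 * N * (mat X 0 0 * (1 + s ^ 2 - 2 * s * mat X 0 0) ^ (-p)) -
          (1 - mat X 0 0 ^ 2) * (2 * s * p * (1 + s ^ 2 - 2 * s * mat X 0 0) ^ (-p - 1)) := by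
        intro X
        have hQ := one_add_sq_sub_pos hs' (hmem X)
        have hpow : (1 + s ^ 2 - 2 * s * mat X 0 0) ^ (-p) =
            (1 + s ^ 2 - 2 * s * mat X 0 0) ^ (-p - 1) * (1 + s ^ 2 - 2 * s * mat X 0 0) := by
          rw [← rpow_add_one hQ.ne']
          ring_nf
        rw [hpow, hp]
        ring
      simp_rw [hrw]
      rw [integral_sub, hibp, sub_self]
      · exact (continuous_const.mul ((continuous_mat_apply 0 0).mul
          (continuous_poisson hs' (-p)))).integrable_of_compactSpace
      · exact ((by fun_prop : Continuous fun X : SOodd N => 1 - mat X 0 0 ^ 2).mul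
          (continuous_const.mul (continuous_poisson hs' (-p - 1)))).integrable_of_compactSpace
    · refine ContinuousOn.add (ContinuousOn.mul (by fun_prop) (continuousOn_poisson (-p)))
        (ContinuousOn.mul (by fun_prop) (ContinuousOn.mul (by fun_prop)
          (continuousOn_poisson (-p - 1))))
  have hconst := isOpen_Ioo.is_const_of_deriv_eq_zero (convex_Ioo (-1 : ℝ) 1).isPreconnected
    (fun s hs => (hder s hs).differentiableAt.differentiableWithinAt)
    (fun s hs => (hder s hs).deriv) (abs_lt.1 hs) (show (0 : ℝ) ∈ Set.Ioo (-1 : ℝ) 1 by simp)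
  rw [hconst]
  simp

end FluxLaw

section Gaussian

variable {N : ℕ}

lemma dotProduct_one_sub_smul_mulVec (X : SOodd N) (s : ℝ) (x : Fin (2 * N + 1) → ℝ) :
    ((1 - s • mat X) *ᵥ x) ⬝ᵥ ((1 - s • mat X) *ᵥ x) =
      (1 + s ^ 2) * (x ⬝ᵥ x) - 2 * s * (x ⬝ᵥ (mat X *ᵥ x)) := by
  have h : (mat X *ᵥ x) ⬝ᵥ (mat X *ᵥ x) = x ⬝ᵥ x := by
    rw [dotProduct_mulVec, vecMul_mulVec, mat_transpose_mul, vecMul_one]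
  have h' : (mat X *ᵥ x) ⬝ᵥ x = x ⬝ᵥ (mat X *ᵥ x) := dotProduct_comm _ _
  simp only [sub_mulVec, one_mulVec, smul_mulVec, sub_dotProduct, dotProduct_sub, smul_dotProduct,
    dotProduct_smul, smul_eq_mul, h, h']
  ring

lemma abs_dotProduct_mat_mulVec_le (X : SOodd N) (x : Fin (2 * N + 1) → ℝ) :
    |x ⬝ᵥ (mat X *ᵥ x)| ≤ x ⬝ᵥ x := by
  obtain ⟨R, hR⟩ := exists_conj_dotProduct_mulVec x
  have hx : 0 ≤ x ⬝ᵥ x := dotProduct_self_star_nonneg x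
  rw [hR, abs_mul, abs_of_nonneg hx]
  exact mul_le_of_le_one_right hx (abs_mat_apply_le_one _ _ _)

lemma charPoly_ne_zero (X : SOodd N) {s : ℝ} (h0 : 0 ≤ s) (h1 : s < 1) : charPoly X s ≠ 0 := by
  intro h
  rw [charPoly_eq] at h
  obtain ⟨v, hv, hv0⟩ := Matrix.exists_mulVec_eq_zero_iff.2 h
  have hq := dotProduct_one_sub_smul_mulVec X s v
  rw [hv0, zero_dotProduct] at hq
  have hle := (abs_le.1 (abs_dotProduct_mat_mulVec_le X v)).2
  have hpos : 0 < v ⬝ᵥ v := lt_of_le_of_ne (dotProduct_self_star_nonneg v)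
    fun h => hv (dotProduct_self_eq_zero.1 h.symm)
  have h2 : 0 < (1 - s) ^ 2 := by have := sub_pos.2 h1; positivity
  nlinarith [mul_pos h2 hpos, mul_le_mul_of_nonneg_left hle h0]

lemma charPoly_pos (X : SOodd N) {s : ℝ} (h0 : 0 ≤ s) (h1 : s < 1) : 0 < charPoly X s := by
  by_contra! hle
  have h00 : charPoly X 0 = 1 := by simp [charPoly]
  obtain ⟨t, ht, hz⟩ := intermediate_value_Icc' h0
    (differentiable_charPoly X).continuous.continuousOn
    (show (0 : ℝ) ∈ Set.Icc _ _ from ⟨hle, by rw [h00]; exact zero_le_one⟩)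
  exact charPoly_ne_zero X ht.1 (ht.2.trans_lt h1) hz

lemma integrable_exp_neg_mul_dotProduct {ι : Type*} [Fintype ι] {b : ℝ} (hb : 0 < b) :
    Integrable fun x : ι → ℝ => exp (-(b * (x ⬝ᵥ x))) := by
  have h := Integrable.fintype_prod (ι := ι) (μ := fun _ => volume)
    (f := fun _ t => exp (-b * t ^ 2))
    fun _ => integrable_exp_neg_mul_sq hb
  refine h.congr (Eventually.of_forall fun x => ?_)
  simp only [dotProduct, ← exp_sum, Finset.mul_sum, ← Finset.sum_neg_distrib]
  congr 1
  exact Finset.sum_congr rfl fun i _ => by ring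

lemma integral_exp_neg_mulVec {ι : Type*} [Fintype ι] [DecidableEq ι] {M : Matrix ι ι ℝ}
    (hM : M.det ≠ 0) : ∫ x : ι → ℝ, exp (-((M *ᵥ x) ⬝ᵥ (M *ᵥ x))) =
      |M.det|⁻¹ * ∫ x : ι → ℝ, exp (-(x ⬝ᵥ x)) := by
  have h := Real.map_matrix_volume_pi_eq_smul_volume_pi hM
  have hc : Continuous fun x : ι → ℝ => exp (-(x ⬝ᵥ x)) := by
    unfold dotProduct
    fun_prop
  have h2 := integral_map (μ := volume) (φ := Matrix.toLin' M)
    (LinearMap.continuous_of_finiteDimensional _).aemeasurable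
    (f := fun x : ι → ℝ => exp (-(x ⬝ᵥ x))) hc.aestronglyMeasurable
  rw [h, integral_smul_measure, ENNReal.toReal_ofReal (abs_nonneg _), abs_inv] at h2
  simpa using h2.symm

lemma integral_exp_neg_mul_dotProduct {n : ℕ} {q : ℝ} (hq : 0 < q) :
    ∫ x : Fin n → ℝ, exp (-(q * (x ⬝ᵥ x))) =
      q ^ (-((n : ℝ) / 2)) * ∫ x : Fin n → ℝ, exp (-(x ⬝ᵥ x)) := by
  have hdet : (√q • (1 : Matrix (Fin n) (Fin n) ℝ)).det = q ^ ((n : ℝ) / 2) := by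
    rw [det_smul, det_one, mul_one, Fintype.card_fin, sqrt_eq_rpow, ← rpow_natCast,
      ← rpow_mul hq.le]
    ring_nf
  have h := integral_exp_neg_mulVec (M := √q • (1 : Matrix (Fin n) (Fin n) ℝ))
    (by rw [hdet]; positivity)
  rw [hdet, abs_of_pos (by positivity), ← rpow_neg hq.le] at h
  rw [← h]
  simp only [smul_mulVec, one_mulVec, smul_dotProduct, dotProduct_smul, smul_eq_mul, ← mul_assoc,
    mul_self_sqrt hq.le]

lemma integral_exp_neg_dotProduct_pos (n : ℕ) : 0 < ∫ x : Fin n → ℝ, exp (-(x ⬝ᵥ x)) := by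
  have h := integrable_exp_neg_mul_dotProduct (ι := Fin n) one_pos
  simp only [one_mul] at h
  exact integral_exp_pos h

/-- A class function divided by the characteristic polynomial integrates like the same function
multiplied by a power of the Poisson denominator of a single matrix entry. -/
lemma integral_div_charPoly (μ : Measure (SOodd N)) [μ.IsHaarMeasure] [IsProbabilityMeasure μ]
    {f : SOodd N → ℝ} (hf : Continuous f) (hclass : ∀ R X, f (R * X * R⁻¹) = f X) {s : ℝ}
    (h0 : 0 ≤ s) (h1 : s < 1) :
    ∫ X, f X / charPoly X s ∂μ =
      ∫ X, f X * (1 + s ^ 2 - 2 * s * mat X 0 0) ^ (-((2 * N + 1 : ℝ) / 2)) ∂μ := by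
  have hs : |s| < 1 := by rwa [abs_of_nonneg h0]
  have hI := integral_exp_neg_dotProduct_pos (2 * N + 1)
  refine mul_right_cancel₀ hI.ne' ?_
  rw [← integral_mul_const, ← integral_mul_const]
  obtain ⟨B, hB⟩ : ∃ B, ∀ X, |f X| ≤ B := by
    obtain ⟨B, hB⟩ := isCompact_univ.exists_bound_of_continuousOn hf.continuousOn
    exact ⟨B, fun X => hB X (Set.mem_univ X)⟩
  have hb : 0 < (1 - s) ^ 2 := by have := sub_pos.2 h1; positivity
  have hdom : Integrable (fun p : SOodd N × (Fin (2 * N + 1) → ℝ) =>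
      B * exp (-((1 - s) ^ 2 * (p.2 ⬝ᵥ p.2)))) (μ.prod volume) :=
    ((integrable_exp_neg_mul_dotProduct hb).comp_snd μ).const_mul B
  have hfst : Continuous fun p : SOodd N × (Fin (2 * N + 1) → ℝ) => f p.1 := hf.comp continuous_fst
  have hm : ∀ i j, Continuous fun p : SOodd N × (Fin (2 * N + 1) → ℝ) => mat p.1 i j := fun i j =>
    (continuous_mat_apply i j).comp continuous_fst
  have hint1 : Integrable (Function.uncurry fun (X : SOodd N) (x : Fin (2 * N + 1) → ℝ) =>
      f X * exp (-((1 + s ^ 2) * (x ⬝ᵥ x) - 2 * s * (x ⬝ᵥ (mat X *ᵥ x))))) (μ.prod volume) := by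
    refine hdom.mono' ?_ (Eventually.of_forall ?_)
    · refine Continuous.aestronglyMeasurable ?_
      simp only [Function.uncurry_def, dotProduct, mulVec]
      fun_prop
    · rintro ⟨X, x⟩
      simp only [Function.uncurry, norm_mul, norm_eq_abs, abs_exp]
      refine mul_le_mul (hB X) (exp_le_exp.2 ?_) (exp_pos _).le ((abs_nonneg _).trans (hB X))
      have := mul_le_mul_of_nonneg_left (abs_le.1 (abs_dotProduct_mat_mulVec_le X x)).2 h0
      nlinarith
  have hint2 : Integrable (Function.uncurry fun (X : SOodd N) (x : Fin (2 * N + 1) → ℝ) =>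
      f X * exp (-((1 + s ^ 2 - 2 * s * mat X 0 0) * (x ⬝ᵥ x)))) (μ.prod volume) := by
    refine hdom.mono' ?_ (Eventually.of_forall ?_)
    · refine Continuous.aestronglyMeasurable ?_
      simp only [Function.uncurry_def, dotProduct]
      fun_prop
    · rintro ⟨X, x⟩
      simp only [Function.uncurry, norm_mul, norm_eq_abs, abs_exp]
      refine mul_le_mul (hB X) (exp_le_exp.2 ?_) (exp_pos _).le ((abs_nonneg _).trans (hB X))
      have hx : 0 ≤ x ⬝ᵥ x := dotProduct_self_star_nonneg x
      have := mul_le_mul_of_nonneg_left (abs_le.1 (abs_mat_apply_le_one X 0 0)).2 h0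
      exact neg_le_neg (mul_le_mul_of_nonneg_right (by nlinarith) hx)
  calc ∫ X, f X / charPoly X s * (∫ x : Fin (2 * N + 1) → ℝ, exp (-(x ⬝ᵥ x))) ∂μ
      = ∫ X, (∫ x : Fin (2 * N + 1) → ℝ,
          f X * exp (-((1 + s ^ 2) * (x ⬝ᵥ x) - 2 * s * (x ⬝ᵥ (mat X *ᵥ x))))) ∂μ := by
        refine integral_congr_ae (Eventually.of_forall fun X => ?_)
        simp only
        rw [integral_const_mul]
        simp_rw [← dotProduct_one_sub_smul_mulVec]
        rw [integral_exp_neg_mulVec (by rw [← charPoly_eq]; exact charPoly_ne_zero X h0 h1),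
          ← charPoly_eq, abs_of_pos (charPoly_pos X h0 h1)]
        ring
    _ = ∫ x : Fin (2 * N + 1) → ℝ, ∫ X,
          f X * exp (-((1 + s ^ 2) * (x ⬝ᵥ x) - 2 * s * (x ⬝ᵥ (mat X *ᵥ x)))) ∂μ :=
        integral_integral_swap hint1
    _ = ∫ x : Fin (2 * N + 1) → ℝ, ∫ X,
          f X * exp (-((1 + s ^ 2 - 2 * s * mat X 0 0) * (x ⬝ᵥ x))) ∂μ := by
        refine integral_congr_ae (Eventually.of_forall fun x => ?_)
        simp only
        obtain ⟨R, hR⟩ := exists_conj_dotProduct_mulVec x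
        rw [← integral_conj_eq μ (fun X => f X *
          exp (-((1 + s ^ 2 - 2 * s * mat X 0 0) * (x ⬝ᵥ x)))) R]
        refine integral_congr_ae (Eventually.of_forall fun X => ?_)
        simp only [hclass, hR X]
        ring_nf
    _ = ∫ X, (∫ x : Fin (2 * N + 1) → ℝ,
          f X * exp (-((1 + s ^ 2 - 2 * s * mat X 0 0) * (x ⬝ᵥ x)))) ∂μ :=
        (integral_integral_swap hint2).symm
    _ = _ := by
        refine integral_congr_ae (Eventually.of_forall fun X => ?_)
        simp only
        rw [integral_const_mul, integral_exp_neg_mul_dotProduct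
          (one_add_sq_sub_pos hs (abs_mat_apply_le_one X 0 0))]
        push_cast
        ring

/-- The mean of the logarithmic derivative of the characteristic polynomial. -/
theorem integral_neg_logDeriv_charPoly (μ : Measure (SOodd N)) [μ.IsHaarMeasure]
    [IsProbabilityMeasure μ] (hN : N ≠ 0) {s : ℝ} (h0 : 0 < s) (h1 : s < 1) :
    ∫ X, -logDeriv (charPoly X) s ∂μ = (s + s ^ (2 * N)) / (1 - s ^ 2) := by
  have hs : |s| < 1 := by rwa [abs_of_pos h0]
  set p : ℝ := (2 * N + 1 : ℝ) / 2 with hp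
  have hcont : Continuous fun X : SOodd N => (1 + s ^ 2 - 2 * s * mat X 0 0) ^ (-p) :=
    continuous_poisson hs (-p)
  set A := ∫ X, (1 + s ^ 2 - 2 * s * mat X 0 0) ^ (-p) ∂μ with hA
  set B := ∫ X, mat X 0 0 * (1 + s ^ 2 - 2 * s * mat X 0 0) ^ (-p) ∂μ with hB
  have hcomb : ∀ u v : ℝ, ∫ X, (u + v * mat X 0 0) * (1 + s ^ 2 - 2 * s * mat X 0 0) ^ (-p) ∂μ =
      u * A + v * B := by
    intro u v
    rw [hA, hB, ← integral_const_mul, ← integral_const_mul, ← integral_add]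
    · exact integral_congr_ae (Eventually.of_forall fun X => by ring)
    · exact (continuous_const.mul hcont).integrable_of_compactSpace
    · exact (continuous_const.mul
        ((continuous_mat_apply 0 0).mul hcont)).integrable_of_compactSpace
  have hflux := integral_flux_eq_one μ hs
  rw [← hp] at hflux
  have e1 : A - s * B = 1 := by
    rw [← hflux, ← sub_eq_zero]
    have := hcomb 1 (-s)
    rw [sub_eq_zero]
    calc A - s * B = 1 * A + -s * B := by ring
      _ = _ := by
        rw [← this]
        exact integral_congr_ae (Eventually.of_forall fun X => by ring)
  have e2 : (1 - s ^ (2 * N + 1)) * A + (s ^ (2 * N) - s) * B = 1 := by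
    have h := integral_div_charPoly μ (continuous_charPoly s)
      (fun R X => by rw [charPoly_conj]) h0.le h1
    rw [← hp, integral_charPoly_mul μ hN (φ := fun c => (1 + s ^ 2 - 2 * s * c) ^ (-p)) hcont] at h
    rw [← hcomb]
    calc _ = ∫ X, charPoly X s / charPoly X s ∂μ := by
          rw [h]
          exact integral_congr_ae (Eventually.of_forall fun X => by ring)
      _ = 1 := by
          simp [div_self (charPoly_ne_zero _ h0.le h1)]
  have e3 : ∫ X, -logDeriv (charPoly X) s ∂μ =
      (2 * N + 1) * s ^ (2 * N) * A + (1 - 2 * N * s ^ (2 * N - 1)) * B := by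
    have h := integral_div_charPoly μ (continuous_deriv_charPoly s)
      (fun R X => by rw [charPoly_conj]) h0.le h1
    rw [← hp, integral_deriv_charPoly_mul μ hN
      (φ := fun c => (1 + s ^ 2 - 2 * s * c) ^ (-p)) hcont] at h
    simp only [logDeriv_apply]
    rw [integral_neg, h, ← integral_neg, ← hcomb]
    exact integral_congr_ae (Eventually.of_forall fun X => by ring)
  have hpow : s ^ (2 * N) = s ^ (2 * N - 1) * s := by
    rw [← pow_succ]
    congr 1
    omega
  rw [e3]
  rw [pow_succ, hpow] at e2
  rw [hpow]
  set w := s ^ (2 * N - 1)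
  have hBA : B = s * A := by
    have : w * s * (B - s * A) = 0 := by linear_combination e2 - e1
    have hw0 : w * s ≠ 0 := by positivity
    linarith [(mul_eq_zero.1 this).resolve_left hw0]
  have hd : 1 - s ^ 2 ≠ 0 := by nlinarith
  rw [eq_div_iff hd, hBA]
  rw [hBA] at e1
  linear_combination (s + w * s) * e1

end Gaussian

section Spectrum

variable {N : ℕ}

lemma charPoly_one (X : SOodd N) : charPoly X 1 = 0 := by
  have h : (1 - mat X).det = -(1 - mat X).det := by
    calc (1 - mat X).det = (mat X * ((mat X)ᵀ - 1)).det := by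
          rw [mul_sub, mat_mul_transpose, mul_one]
      _ = ((mat X)ᵀ - 1).det := by rw [det_mul, det_mat, one_mul]
      _ = (mat X - 1).det := by rw [← det_transpose]; simp
      _ = -(1 - mat X).det := by
          rw [← neg_sub 1 (mat X), det_neg]
          simp [pow_add, pow_mul]
  rw [charPoly_eq, one_smul]
  linarith

/-- The square of the characteristic polynomial factors over the real parts of the eigenvalues,
one of which is equal to one. -/
lemma exists_charPoly_sq_eq (X : SOodd N) : ∃ c : Fin (2 * N) → ℝ, (∀ i, c i ≤ 1) ∧
    ∀ s, s ≠ 0 → charPoly X s ^ 2 = (1 - s) ^ 2 * ∏ i, (1 + s ^ 2 - 2 * s * c i) := by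
  have hH : (mat X + (mat X)ᵀ).IsHermitian := by
    rw [IsHermitian, conjTranspose_eq_transpose_of_trivial, transpose_add, transpose_transpose]
    exact add_comm _ _
  set e := hH.eigenvalues with he
  have hle : ∀ i, e i ≤ 2 := by
    intro i
    set v := (hH.eigenvectorBasis i).ofLp with hv
    have hvv : v ⬝ᵥ v = 1 := by
      have h := hH.eigenvectorBasis.orthonormal.1 i
      have h2 : ‖hH.eigenvectorBasis i‖ ^ 2 = v ⬝ᵥ v := by
        rw [EuclideanSpace.real_norm_sq_eq, dotProduct]
        simp only [sq, hv]
      rw [← h2, h, one_pow]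
    have h := hH.eigenvalues_eq i
    have ht : v ⬝ᵥ ((mat X)ᵀ *ᵥ v) = v ⬝ᵥ (mat X *ᵥ v) := by
      rw [mulVec_transpose, dotProduct_comm, dotProduct_mulVec]
    rw [← hv, star_trivial, add_mulVec, dotProduct_add, ht] at h
    have hb := (abs_le.1 (abs_dotProduct_mat_mulVec_le X v)).2
    rw [he, h]
    simp only [RCLike.re_to_real]
    linarith
  have hprod : ∀ s, s ≠ 0 → charPoly X s ^ 2 = ∏ i, (1 + s ^ 2 - s * e i) := by
    intro s hs
    have hev := congrArg (Polynomial.eval ((1 + s ^ 2) / s)) hH.charpoly_eq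
    rw [eval_charpoly, Polynomial.eval_prod] at hev
    simp only [Polynomial.eval_sub, Polynomial.eval_X, Polynomial.eval_C] at hev
    have hm : (1 - s • mat X) * (1 - s • (mat X)ᵀ) =
        s • (scalar (Fin (2 * N + 1)) ((1 + s ^ 2) / s) - (mat X + (mat X)ᵀ)) := by
      have hsc : s • scalar (Fin (2 * N + 1)) ((1 + s ^ 2) / s) =
          (1 + s ^ 2) • (1 : Matrix (Fin (2 * N + 1)) (Fin (2 * N + 1)) ℝ) := by
        rw [scalar_apply, ← smul_one_eq_diagonal, smul_smul, mul_div_cancel₀ _ hs]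
      rw [smul_sub, hsc]
      simp only [sub_mul, mul_sub, one_mul, mul_one, smul_mul_assoc, mul_smul_comm,
        mat_mul_transpose]
      module
    have hc : charPoly X s ^ 2 = ((1 - s • mat X) * (1 - s • (mat X)ᵀ)).det := by
      rw [det_mul, ← charPoly_eq, sq]
      rfl
    rw [hc, hm, det_smul, hev, Fintype.card_fin]
    have := Finset.prod_const (s := (Finset.univ : Finset (Fin (2 * N + 1)))) s
    rw [Finset.card_univ, Fintype.card_fin] at this
    rw [← this, ← Finset.prod_mul_distrib]
    refine Finset.prod_congr rfl fun i _ => ?_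
    simp only [RCLike.ofReal_real_eq_id, id, ← he]
    field_simp
  obtain ⟨i₀, hi₀⟩ : ∃ i, e i = 2 := by
    have h := hprod 1 one_ne_zero
    rw [charPoly_one] at h
    obtain ⟨i, -, hi⟩ := Finset.prod_eq_zero_iff.1 (h.symm.trans (by norm_num))
    exact ⟨i, by linarith⟩
  refine ⟨fun i => e (i₀.succAbove i) / 2, fun i => by linarith [hle (i₀.succAbove i)],
    fun s hs => ?_⟩
  rw [hprod s hs, Fin.prod_univ_succAbove _ i₀, hi₀]
  congr 1
  · ring
  · exact Finset.prod_congr rfl fun i _ => by ring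

lemma neg_logDeriv_eq_of_sq_eq {ι : Type*} [Fintype ι] {f : ℝ → ℝ} (hf : Differentiable ℝ f)
    {c : ι → ℝ} (hc : ∀ i, c i ≤ 1)
    (hsq : ∀ s, s ≠ 0 → f s ^ 2 = (1 - s) ^ 2 * ∏ i, (1 + s ^ 2 - 2 * s * c i)) {s : ℝ}
    (h0 : 0 < s) (h1 : s < 1) :
    -logDeriv f s = 1 / (1 - s) + ∑ i, (c i - s) / (1 + s ^ 2 - 2 * s * c i) := by
  have hQ : ∀ i, 1 + s ^ 2 - 2 * s * c i ≠ 0 := by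
    intro i
    have : 0 < (1 - s) ^ 2 := by have := sub_pos.2 h1; positivity
    nlinarith [mul_le_mul_of_nonneg_left (hc i) h0.le]
  have hs1 : (1 - s) ≠ 0 := (sub_pos.2 h1).ne'
  have hev : (fun s => f s ^ 2) =ᶠ[nhds s]
      fun s => (1 - s) ^ 2 * ∏ i, (1 + s ^ 2 - 2 * s * c i) := by
    filter_upwards [isOpen_ne.mem_nhds h0.ne'] with t ht using hsq t ht
  have h2 : logDeriv (fun s => f s ^ 2) s =
      logDeriv (fun s => (1 - s) ^ 2 * ∏ i, (1 + s ^ 2 - 2 * s * c i)) s := by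
    rw [logDeriv_apply, logDeriv_apply, hev.deriv_eq, hev.eq_of_nhds]
  have hd : ∀ i, HasDerivAt (fun s => 1 + s ^ 2 - 2 * s * c i) (2 * s - 2 * c i) s := by
    intro i
    refine (((hasDerivAt_pow 2 s).const_add 1).sub
      (((hasDerivAt_id s).const_mul 2).mul_const (c i))).congr_deriv ?_
    simp
  have hd1 : HasDerivAt (fun s : ℝ => 1 - s) (-1) s := by
    simpa using (hasDerivAt_id s).const_sub 1
  rw [logDeriv_fun_pow (hf s), logDeriv_mul (f := fun s => (1 - s) ^ 2)
    (g := fun s => ∏ i, (1 + s ^ 2 - 2 * s * c i)) s (pow_ne_zero 2 hs1)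
    (Finset.prod_ne_zero_iff.2 fun i _ => hQ i) (by fun_prop) (by fun_prop),
    logDeriv_fun_pow hd1.differentiableAt, logDeriv_prod (fun i _ => hQ i)
    (fun i _ => (hd i).differentiableAt)] at h2
  simp only [logDeriv_apply, hd1.deriv, (hd _).deriv] at h2
  have hsum : ∑ i, (2 * s - 2 * c i) / (1 + s ^ 2 - 2 * s * c i) =
      -2 * ∑ i, (c i - s) / (1 + s ^ 2 - 2 * s * c i) := by
    rw [Finset.mul_sum]
    exact Finset.sum_congr rfl fun i _ => by ring
  rw [hsum] at h2
  push_cast at h2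
  rw [logDeriv_apply]
  linear_combination (-1 / 2) * h2

/-- The contribution to the logarithmic derivative of the eigenvalues other than the
deterministic eigenvalue one. -/
def fluct (X : SOodd N) (x : ℝ) : ℝ :=
  exp (-x) * -logDeriv (charPoly X) (exp (-x)) - 1 / (exp x - 1) + N

lemma exists_fluct_eq (X : SOodd N) : ∃ c : Fin (2 * N) → ℝ, (∀ i, c i ≤ 1) ∧
    ∀ x, 0 < x → fluct X x = ∑ i, sinh x / 2 * (1 / (cosh x - c i)) := by
  obtain ⟨c, hc, hsq⟩ := exists_charPoly_sq_eq X
  refine ⟨c, hc, fun x hx => ?_⟩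
  have hs0 := exp_pos (-x)
  have hs1 : exp (-x) < 1 := by simpa using hx
  rw [fluct, neg_logDeriv_eq_of_sq_eq (differentiable_charPoly X) hc hsq hs0 hs1, sinh_eq, cosh_eq]
  have hex : exp x = (exp (-x))⁻¹ := by rw [exp_neg, inv_inv]
  rw [hex]
  set s := exp (-x)
  have h1s : 1 - s ≠ 0 := (sub_pos.2 hs1).ne'
  have hterm : ∀ i, (s⁻¹ - s) / 2 / 2 * (1 / ((s⁻¹ + s) / 2 - c i)) =
      s * ((c i - s) / (1 + s ^ 2 - 2 * s * c i)) + 1 / 2 := by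
    intro i
    have hQ : 1 + s ^ 2 - 2 * s * c i ≠ 0 := by
      have : 0 < (1 - s) ^ 2 := by have := sub_pos.2 hs1; positivity
      nlinarith [mul_le_mul_of_nonneg_left (hc i) hs0.le]
    have hQ' : (s⁻¹ + s) / 2 - c i = (1 + s ^ 2 - 2 * s * c i) / (2 * s) := by
      field_simp
    have hcs : c i - s = (1 - s ^ 2 - (1 + s ^ 2 - 2 * s * c i)) / (2 * s) := by
      field_simp
      ring
    rw [hQ', hcs]
    set Q := 1 + s ^ 2 - 2 * s * c i
    field_simp
    ring
  simp_rw [hterm]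
  rw [Finset.sum_add_distrib, ← Finset.mul_sum]
  have : s⁻¹ - 1 = (1 - s) / s := by field_simp
  rw [this]
  simp
  field_simp
  ring_nf

lemma fluct_nonneg (X : SOodd N) {x : ℝ} (hx : 0 < x) : 0 ≤ fluct X x := by
  obtain ⟨c, hc, hf⟩ := exists_fluct_eq X
  rw [hf x hx]
  refine Finset.sum_nonneg fun i _ => ?_
  have := one_lt_cosh.2 hx.ne'
  have := sinh_pos_iff.2 hx
  have : 0 < cosh x - c i := by linarith [hc i]
  positivity

lemma fluct_le (X : SOodd N) {x : ℝ} (hx : 0 < x) :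
    fluct X x ≤ N * (sinh x / (cosh x - 1)) := by
  obtain ⟨c, hc, hf⟩ := exists_fluct_eq X
  rw [hf x hx]
  have h1 := one_lt_cosh.2 hx.ne'
  have h2 := sinh_pos_iff.2 hx
  have h3 : 0 < cosh x - 1 := by linarith
  have hle : ∀ i ∈ Finset.univ, sinh x / 2 * (1 / (cosh x - c i)) ≤
      sinh x / 2 * (1 / (cosh x - 1)) := by
    intro i _
    refine mul_le_mul_of_nonneg_left (one_div_le_one_div_of_le h3 ?_) (by positivity)
    linarith [hc i]
  refine (Finset.sum_le_card_nsmul _ _ _ hle).trans (le_of_eq ?_)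
  simp
  ring

/-- The second moment of the fluctuation is controlled by comparing it at two scales. -/
lemma fluct_sq_le (X : SOodd N) {x : ℝ} (hx : 0 < x) :
    fluct X x ^ 2 ≤
      2 * N * (cosh x + 1) * (fluct X x / sinh x - fluct X (2 * x) / sinh (2 * x)) := by
  obtain ⟨c, hc, hf⟩ := exists_fluct_eq X
  have h2x : 0 < 2 * x := by linarith
  rw [hf x hx, hf _ h2x]
  have h1 := one_lt_cosh.2 hx.ne'
  have h2 := sinh_pos_iff.2 hx
  have h3 := sinh_pos_iff.2 h2x
  have hs2 := sinh_sq x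
  have hc2 : cosh (2 * x) = 2 * cosh x ^ 2 - 1 := by
    rw [cosh_two_mul, hs2]
    ring
  rw [← Finset.mul_sum, ← Finset.mul_sum, hc2]
  set u := cosh x
  have e1 : sinh x / 2 * (∑ i, 1 / (u - c i)) / sinh x = (∑ i, 1 / (u - c i)) / 2 := by
    field_simp
  have e2 : sinh (2 * x) / 2 * (∑ i, 1 / (2 * u ^ 2 - 1 - c i)) / sinh (2 * x) =
      (∑ i, 1 / (2 * u ^ 2 - 1 - c i)) / 2 := by
    field_simp
  rw [e1, e2, mul_pow, div_pow, hs2, ← sub_div, ← Finset.sum_sub_distrib]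
  have hcs := sq_sum_le_card_mul_sum_sq (s := Finset.univ) (f := fun i => 1 / (u - c i))
  simp only [Finset.card_univ, Fintype.card_fin] at hcs
  push_cast at hcs
  have hterm : ∀ i, (u - 1) * (1 / (u - c i)) ^ 2 ≤
      2 * (1 / (u - c i) - 1 / (2 * u ^ 2 - 1 - c i)) := by
    intro i
    have p1 : 0 < u - c i := by linarith [hc i]
    have p2 : 0 < 2 * u ^ 2 - 1 - c i := by nlinarith [hc i]
    rw [div_sub_div _ _ p1.ne' p2.ne', div_pow, one_pow, mul_one_div, mul_div_assoc',
      div_le_div_iff₀ (by positivity) (by positivity)]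
    have key : (u - 1) * (2 * u ^ 2 - 1 - c i) ≤ 2 * (2 * u ^ 2 - 1 - u) * (u - c i) := by
      have : 2 * (2 * u ^ 2 - 1 - u) * (u - c i) - (u - 1) * (2 * u ^ 2 - 1 - c i) =
          (u - 1) * (4 * u + 1) * (1 - c i) + 2 * u * (u - 1) ^ 2 := by ring
      have h4 : 0 ≤ (u - 1) * (4 * u + 1) * (1 - c i) :=
        mul_nonneg (mul_nonneg (by linarith) (by linarith)) (by linarith [hc i])
      have h5 : 0 ≤ 2 * u * (u - 1) ^ 2 := by positivity
      linarith
    calc (u - 1) * ((u - c i) * (2 * u ^ 2 - 1 - c i))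
        = (u - 1) * (2 * u ^ 2 - 1 - c i) * (u - c i) := by ring
      _ ≤ 2 * (2 * u ^ 2 - 1 - u) * (u - c i) * (u - c i) :=
          mul_le_mul_of_nonneg_right key p1.le
      _ = _ := by ring
  have hsum := Finset.sum_le_sum fun i (_ : i ∈ Finset.univ) => hterm i
  rw [← Finset.mul_sum, ← Finset.mul_sum] at hsum
  set S2 := ∑ i, (1 / (u - c i)) ^ 2
  set D := ∑ i, (1 / (u - c i) - 1 / (2 * u ^ 2 - 1 - c i))
  have hN : (0 : ℝ) ≤ N := N.cast_nonneg
  calc (u ^ 2 - 1) / 2 ^ 2 * (∑ i, 1 / (u - c i)) ^ 2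
      ≤ (u ^ 2 - 1) / 2 ^ 2 * (2 * N * S2) := mul_le_mul_of_nonneg_left hcs (by nlinarith)
    _ = N * (u + 1) / 2 * ((u - 1) * S2) := by ring
    _ ≤ N * (u + 1) / 2 * (2 * D) := mul_le_mul_of_nonneg_left hsum (by positivity)
    _ = _ := by ring

lemma continuous_fluct {x : ℝ} (hx : 0 < x) : Continuous fun X : SOodd N => fluct X x := by
  have hs1 : exp (-x) < 1 := by simpa using hx
  have h : Continuous fun X : SOodd N => logDeriv (charPoly X) (exp (-x)) :=
    (continuous_deriv_charPoly _).div (continuous_charPoly _)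
      fun X => charPoly_ne_zero X (exp_pos _).le hs1
  unfold fluct
  fun_prop

lemma integral_fluct (μ : Measure (SOodd N)) [μ.IsHaarMeasure] [IsProbabilityMeasure μ]
    (hN : N ≠ 0) {x : ℝ} (hx : 0 < x) :
    ∫ X, fluct X x ∂μ = N - (1 - exp (-(2 * N * x))) / (2 * sinh x) := by
  have hs0 := exp_pos (-x)
  have hs1 : exp (-x) < 1 := by simpa using hx
  have hpow : exp (-(2 * N * x)) = exp (-x) ^ (2 * N) := by
    rw [← exp_nat_mul]
    push_cast
    ring_nf
  have hc : Continuous fun X : SOodd N => exp (-x) * -logDeriv (charPoly X) (exp (-x)) := by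
    have := continuous_fluct (N := N) hx
    have h2 : Continuous fun X : SOodd N => fluct X x + 1 / (exp x - 1) - N := by fun_prop
    refine h2.congr fun X => ?_
    rw [fluct]
    ring
  unfold fluct
  simp_rw [sub_add]
  rw [integral_sub hc.integrable_of_compactSpace (integrable_const _), integral_const_mul,
    integral_neg_logDeriv_charPoly μ hN hs0 hs1, integral_const, hpow, sinh_eq]
  have hex : exp x = (exp (-x))⁻¹ := by rw [exp_neg, inv_inv]
  rw [hex]
  set s := exp (-x)
  have h1s : 1 - s ≠ 0 := (sub_pos.2 hs1).ne'
  have h1s2 : 1 - s ^ 2 ≠ 0 := by nlinarith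
  have d1 : s⁻¹ - 1 = (1 - s) / s := by field_simp
  have d2 : 2 * ((s⁻¹ - s) / 2) = (1 - s ^ 2) / s := by field_simp
  rw [d1, d2]
  simp only [probReal_univ, one_smul]
  have d3 : 1 / ((1 - s) / s) = s * (1 + s) / (1 - s ^ 2) := by
    rw [one_div_div, div_eq_div_iff h1s h1s2]
    ring
  rw [d3]
  field_simp
  ring

end Spectrum

section Taylor

lemma rpow_le_two_rpow_abs {u : ℝ} (h1 : 1 / 2 ≤ u) (h2 : u ≤ 2) (p : ℝ) : u ^ p ≤ 2 ^ |p| := by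
  rcases le_total 0 p with hp | hp
  · rw [abs_of_nonneg hp]
    exact rpow_le_rpow (by linarith) h2 hp
  · rw [abs_of_nonpos hp, rpow_neg two_pos.le, ← inv_rpow two_pos.le]
    exact rpow_le_rpow_of_nonpos (by norm_num) (by linarith) hp

lemma abs_le_mul_pow_of_deriv {f f' : ℝ → ℝ} {r C : ℝ} {k : ℕ} (hC : 0 ≤ C)
    (hf : ∀ t, |t| ≤ r → HasDerivAt f (f' t) t) (h0 : f 0 = 0)
    (hf' : ∀ t, |t| ≤ r → |f' t| ≤ C * |t| ^ k) {t : ℝ} (ht : |t| ≤ r) :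
    |f t| ≤ C * |t| ^ (k + 1) := by
  have hmem : ∀ u ∈ Set.Icc (-|t|) |t|, |u| ≤ |t| := fun u hu => abs_le.2 hu
  have h := Convex.norm_image_sub_le_of_norm_hasDerivWithin_le (f := f) (f' := f')
    (s := Set.Icc (-|t|) |t|) (x := 0) (y := t) (C := C * |t| ^ k)
    (fun u hu => (hf u ((hmem u hu).trans ht)).hasDerivWithinAt)
    (fun u hu => (hf' u ((hmem u hu).trans ht)).trans
      (mul_le_mul_of_nonneg_left (pow_le_pow_left₀ (abs_nonneg u) (hmem u hu) k) hC))
    (convex_Icc _ _) (by simp) (abs_le.1 le_rfl)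
  rw [h0, sub_zero, sub_zero, norm_eq_abs, norm_eq_abs] at h
  calc |f t| ≤ C * |t| ^ k * |t| := h
    _ = _ := by ring

lemma hasDerivAt_one_add_rpow {t : ℝ} (ht : |t| ≤ 1 / 2) (K : ℝ) :
    HasDerivAt (fun t => (1 + t) ^ K) (K * (1 + t) ^ (K - 1)) t := by
  have hpos : 0 < 1 + t := by linarith [(abs_le.1 ht).1]
  simpa using ((hasDerivAt_id t).const_add 1).rpow_const (p := K) (Or.inl hpos.ne')

lemma exists_abs_one_add_rpow_sub_one_le (K : ℝ) : ∃ C : ℝ, 0 ≤ C ∧ ∀ t : ℝ, |t| ≤ 1 / 2 →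
    |(1 + t) ^ K - 1| ≤ C * |t| := by
  refine ⟨|K| * 2 ^ |K - 1|, by positivity, fun t ht => ?_⟩
  have h := abs_le_mul_pow_of_deriv (k := 0) (f := fun t => (1 + t) ^ K - 1) (r := 1 / 2)
    (C := |K| * 2 ^ |K - 1|) (by positivity)
    (fun t ht => (hasDerivAt_one_add_rpow ht K).sub_const 1) (by simp) (fun t ht => ?_) ht
  · simpa using h
  · have h2 := abs_le.1 ht
    have h3 : 0 < 1 + t := by linarith
    rw [abs_mul, abs_of_pos (rpow_pos_of_pos h3 _), pow_zero, mul_one]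
    exact mul_le_mul_of_nonneg_left (rpow_le_two_rpow_abs (by linarith) (by linarith) _)
      (abs_nonneg K)

lemma exists_abs_one_add_rpow_sub_linear_le (K : ℝ) : ∃ C : ℝ, 0 ≤ C ∧ ∀ t : ℝ, |t| ≤ 1 / 2 →
    |(1 + t) ^ K - 1 - K * t| ≤ C * |t| ^ 2 := by
  obtain ⟨C, hC, h⟩ := exists_abs_one_add_rpow_sub_one_le (K - 1)
  refine ⟨|K| * C, by positivity, fun t ht => ?_⟩
  refine abs_le_mul_pow_of_deriv (k := 1) (f := fun t => (1 + t) ^ K - 1 - K * t) (r := 1 / 2)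
    (f' := fun t => K * ((1 + t) ^ (K - 1) - 1)) (by positivity)
    (fun t ht => ?_) (by simp) (fun t ht => ?_) ht
  · refine (((hasDerivAt_one_add_rpow ht K).sub_const 1).sub
      ((hasDerivAt_id t).const_mul K)).congr_deriv ?_
    ring
  · rw [abs_mul, pow_one, mul_assoc]
    exact mul_le_mul_of_nonneg_left (h t ht) (abs_nonneg K)

lemma exists_abs_one_add_rpow_sub_quadratic_le (K : ℝ) : ∃ C : ℝ, 0 ≤ C ∧ ∀ t : ℝ, |t| ≤ 1 / 2 →
    |(1 + t) ^ K - 1 - K * t - K * (K - 1) / 2 * t ^ 2| ≤ C * |t| ^ 3 := by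
  obtain ⟨C, hC, h⟩ := exists_abs_one_add_rpow_sub_linear_le (K - 1)
  refine ⟨|K| * C, by positivity, fun t ht => ?_⟩
  refine abs_le_mul_pow_of_deriv (k := 2)
    (f := fun t => (1 + t) ^ K - 1 - K * t - K * (K - 1) / 2 * t ^ 2) (r := 1 / 2)
    (f' := fun t => K * ((1 + t) ^ (K - 1) - 1 - (K - 1) * t)) (by positivity)
    (fun t ht => ?_) (by simp) (fun t ht => ?_) ht
  · refine ((((hasDerivAt_one_add_rpow ht K).sub_const 1).sub
      ((hasDerivAt_id t).const_mul K)).sub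
      ((hasDerivAt_pow 2 t).const_mul (K * (K - 1) / 2))).congr_deriv ?_
    push_cast
    ring
  · rw [abs_mul, mul_assoc]
    exact mul_le_mul_of_nonneg_left (h t ht) (abs_nonneg K)

lemma abs_add_rpow_sub_linear_le (K : ℝ) {y U : ℝ} (hy : 1 / 2 ≤ y) (hy2 : y ≤ 2) (hU : 0 ≤ U) :
    |(y + U) ^ K - y ^ K - K * y ^ (K - 1) * U| ≤
      |K| * |K - 1| * 2 ^ |K - 2| * (1 + U) ^ max (K - 2) 0 * U ^ 2 := by
  have hpos : ∀ t ∈ Set.Icc (0 : ℝ) U, 0 < y + t := fun t ht => by linarith [ht.1]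
  have hd : ∀ p : ℝ, ∀ t ∈ Set.Icc (0 : ℝ) U,
      HasDerivAt (fun t => (y + t) ^ p) (p * (y + t) ^ (p - 1)) t := by
    intro p t ht
    simpa using ((hasDerivAt_id t).const_add y).rpow_const (p := p) (Or.inl (hpos t ht).ne')
  set D := 2 ^ |K - 2| * (1 + U) ^ max (K - 2) 0 with hD
  have hD0 : 0 ≤ D := by positivity
  have hbound : ∀ t ∈ Set.Icc (0 : ℝ) U, (y + t) ^ (K - 2) ≤ D := by
    intro t ht
    rcases le_total 0 (K - 2) with h | h
    · rw [hD, max_eq_left h, abs_of_nonneg h, ← mul_rpow two_pos.le (by linarith)]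
      exact rpow_le_rpow (hpos t ht).le (by linarith [ht.2]) h
    · rw [hD, max_eq_right h, rpow_zero, mul_one, abs_of_nonpos h, rpow_neg two_pos.le,
        ← inv_rpow two_pos.le]
      exact rpow_le_rpow_of_nonpos (by norm_num) (by linarith [ht.1]) h
  have hmem0 : (0 : ℝ) ∈ Set.Icc 0 U := ⟨le_rfl, hU⟩
  have hmemU : U ∈ Set.Icc 0 U := ⟨hU, le_rfl⟩
  have hfirst : ∀ t ∈ Set.Icc (0 : ℝ) U,
      |(y + t) ^ (K - 1) - y ^ (K - 1)| ≤ |K - 1| * D * U := by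
    intro t ht
    have h := Convex.norm_image_sub_le_of_norm_hasDerivWithin_le
      (f := fun t => (y + t) ^ (K - 1)) (s := Set.Icc 0 U) (C := |K - 1| * D)
      (fun u hu => (hd (K - 1) u hu).hasDerivWithinAt) (fun u hu => ?_) (convex_Icc _ _) hmem0 ht
    · simp only [norm_eq_abs, sub_zero, add_zero] at h
      refine h.trans (mul_le_mul_of_nonneg_left ?_ (by positivity))
      rw [abs_of_nonneg ht.1]
      exact ht.2
    · have he : K - 1 - 1 = K - 2 := by ring
      rw [norm_eq_abs, abs_mul, he, abs_of_pos (rpow_pos_of_pos (hpos u hu) _)]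
      exact mul_le_mul_of_nonneg_left (hbound u hu) (abs_nonneg _)
  have h := Convex.norm_image_sub_le_of_norm_hasDerivWithin_le
    (f := fun t => (y + t) ^ K - K * y ^ (K - 1) * t) (s := Set.Icc 0 U)
    (f' := fun t => K * ((y + t) ^ (K - 1) - y ^ (K - 1)))
    (C := |K| * (|K - 1| * D * U))
    (fun u hu => ?_) (fun u hu => ?_) (convex_Icc _ _) hmem0 hmemU
  · simp only [norm_eq_abs, sub_zero, add_zero, mul_zero, abs_of_nonneg hU] at h
    calc _ = |(y + U) ^ K - K * y ^ (K - 1) * U - y ^ K| := by ring_nf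
      _ ≤ _ := h
      _ = _ := by rw [hD]; ring
  · refine ((hd K u hu).sub ((hasDerivAt_id u).const_mul _)).hasDerivWithinAt.congr_deriv ?_
    ring
  · rw [norm_eq_abs, abs_mul]
    exact mul_le_mul_of_nonneg_left (hfirst u hu) (abs_nonneg _)

lemma abs_exp_sub_quadratic_le {x : ℝ} (hx : |x| ≤ 1) :
    |exp x - (1 + x + x ^ 2 / 2)| ≤ |x| ^ 3 * (2 / 9) := by
  have h := exp_bound hx (n := 3) (by norm_num)
  have e : ∑ m ∈ Finset.range 3, x ^ m / (m.factorial : ℝ) = 1 + x + x ^ 2 / 2 := by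
    simp [Finset.sum_range_succ, Nat.factorial]
  rw [e] at h
  refine h.trans (mul_le_mul_of_nonneg_left ?_ (by positivity))
  norm_num [Nat.factorial]

lemma abs_exp_sub_cubic_le {x : ℝ} (hx : |x| ≤ 1) :
    |exp x - (1 + x + x ^ 2 / 2 + x ^ 3 / 6)| ≤ |x| ^ 4 := by
  have h := exp_bound hx (n := 4) (by norm_num)
  have e : ∑ m ∈ Finset.range 4, x ^ m / (m.factorial : ℝ) = 1 + x + x ^ 2 / 2 + x ^ 3 / 6 := by
    simp [Finset.sum_range_succ, Nat.factorial]
  rw [e] at h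
  refine h.trans (mul_le_of_le_one_right (by positivity) ?_)
  norm_num [Nat.factorial]

lemma sinh_le_add_cube {x : ℝ} (h0 : 0 ≤ x) (h1 : x ≤ 1) : sinh x ≤ x + x ^ 3 := by
  have a := abs_exp_sub_quadratic_le (x := x) (by rwa [abs_of_nonneg h0])
  have b := abs_exp_sub_quadratic_le (x := -x) (by rwa [abs_neg, abs_of_nonneg h0])
  rw [abs_neg] at b
  rw [abs_of_nonneg h0, abs_le] at a b
  rw [sinh_eq]
  have : 0 ≤ x ^ 3 := by positivity
  nlinarith [a.1, a.2, b.1, b.2]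

/-- The leading term of `x / (1 - e⁻ˣ) - a eˣ`. -/
lemma abs_edge_sub_le {x a : ℝ} (hx : 0 < x) (hxa : x ≤ a) (ha : a ≤ 1 / 8) :
    |exp x * (x / (exp x - 1) - a) - (1 + (x / 2 - a + x ^ 2 / 12 - a * x))| ≤ 10 * a ^ 3 := by
  have hx1 : |x| ≤ 1 := by rw [abs_of_pos hx]; linarith
  have a1 := abs_le.1 (abs_exp_sub_quadratic_le hx1)
  have a2 := abs_le.1 (abs_exp_sub_cubic_le hx1)
  rw [abs_of_pos hx] at a1 a2
  have h1 : x ≤ exp x - 1 := by linarith [add_one_le_exp x]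
  have hpos : 0 < exp x - 1 := by linarith
  have hxx : x ^ 3 ≤ a ^ 3 := pow_le_pow_left₀ hx.le hxa 3
  have hA : |exp x * (x / (exp x - 1)) - (1 + x / 2 + x ^ 2 / 12)| ≤ 5 * x ^ 3 := by
    have e : exp x * (x / (exp x - 1)) - (1 + x / 2 + x ^ 2 / 12) =
        (exp x * x - (1 + x / 2 + x ^ 2 / 12) * (exp x - 1)) / (exp x - 1) := by
      field_simp
    rw [e, abs_div, abs_of_pos hpos, div_le_iff₀ hpos]
    refine le_trans ?_ (mul_le_mul_of_nonneg_left h1 (by positivity))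
    have e2 : exp x * x - (1 + x / 2 + x ^ 2 / 12) * (exp x - 1) =
        (x / 2 - 1 - x ^ 2 / 12) * (exp x - (1 + x + x ^ 2 / 2 + x ^ 3 / 6)) +
          x ^ 4 * (1 / 24 - x / 72) := by ring
    rw [e2]
    have b1 : |x / 2 - 1 - x ^ 2 / 12| ≤ 2 := by
      rw [abs_le]
      constructor <;> nlinarith
    have b2 : |exp x - (1 + x + x ^ 2 / 2 + x ^ 3 / 6)| ≤ x ^ 4 := abs_le.2 a2
    have b3 : |1 / 24 - x / 72| ≤ 1 := by
      rw [abs_le]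
      constructor <;> linarith
    calc _ ≤ |x / 2 - 1 - x ^ 2 / 12| * |exp x - (1 + x + x ^ 2 / 2 + x ^ 3 / 6)| +
          x ^ 4 * |1 / 24 - x / 72| := by
          refine (abs_add_le _ _).trans (le_of_eq ?_)
          rw [abs_mul, abs_mul, abs_of_nonneg (by positivity : 0 ≤ x ^ 4)]
      _ ≤ 2 * x ^ 4 + x ^ 4 * 1 := by gcongr
      _ ≤ _ := by nlinarith [pow_pos hx 4]
  have hB : |a * exp x - (a + a * x)| ≤ 5 * a ^ 3 := by
    have e : a * exp x - (a + a * x) = a * (exp x - (1 + x + x ^ 2 / 2)) + a * x ^ 2 / 2 := by ring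
    have hax : a * x ^ 2 ≤ a ^ 3 := by nlinarith [pow_le_pow_left₀ hx.le hxa 2]
    have hax3 : a * x ^ 3 ≤ a ^ 3 := by nlinarith [pow_pos hx 3]
    have hax0 : 0 ≤ a * x ^ 2 := by have := hx.le.trans hxa; positivity
    rw [e, abs_le]
    constructor <;> nlinarith
  rw [abs_le] at hA hB ⊢
  constructor <;> nlinarith

lemma abs_edge_sub_one_le {x a : ℝ} (hx : 0 < x) (hxa : x ≤ a) (ha : a ≤ 1 / 8) :
    |exp x * (x / (exp x - 1) - a) - 1| ≤ 2 * a := by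
  have h := abs_le.1 (abs_edge_sub_le hx hxa ha)
  have ha0 : 0 < a := hx.trans_le hxa
  have h3 : a ^ 3 ≤ a * (1 / 64) := by
    calc a ^ 3 = a * a ^ 2 := by ring
      _ ≤ a * (1 / 8) ^ 2 := by gcongr
      _ = _ := by ring
  have h2 : x ^ 2 ≤ x * (1 / 8) := by nlinarith
  have h4 : a * x ≤ x * (1 / 8) := by nlinarith
  have h5 : 0 ≤ a * x := mul_nonneg (hx.le.trans hxa) hx.le
  rw [abs_le]
  constructor <;> nlinarith

/-- Second-order expansion of the deterministic part of the moments. -/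
lemma exists_abs_edge_rpow_sub_le (K : ℝ) : ∃ C, 0 ≤ C ∧ ∀ x a : ℝ, 0 < x → x ≤ a → a ≤ 1 / 8 →
    |(exp x * (x / (exp x - 1) - a)) ^ K - (1 + K * (x / 2 - a + x ^ 2 / 12 - a * x) +
      K * (K - 1) / 2 * (a ^ 2 - a * x + x ^ 2 / 4))| ≤ C * a ^ 3 := by
  obtain ⟨C, hC, h⟩ := exists_abs_one_add_rpow_sub_quadratic_le K
  refine ⟨C * 8 + |K| * 10 + |K * (K - 1) / 2| * 100, by positivity, fun x a hx hxa ha => ?_⟩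
  have ha0 : 0 < a := hx.trans_le hxa
  set d := exp x * (x / (exp x - 1) - a) - 1 with hd
  have e : exp x * (x / (exp x - 1) - a) = 1 + d := by rw [hd]; ring
  have h1 : |d| ≤ 2 * a := abs_edge_sub_one_le hx hxa ha
  have h2 : |d - (x / 2 - a + x ^ 2 / 12 - a * x)| ≤ 10 * a ^ 3 := by
    have := abs_edge_sub_le hx hxa ha
    rw [e] at this
    convert this using 2
    ring
  have h3 := h d (by linarith)
  have h4 : |d| ^ 3 ≤ 8 * a ^ 3 := by
    calc |d| ^ 3 ≤ (2 * a) ^ 3 := pow_le_pow_left₀ (abs_nonneg d) h1 3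
      _ = _ := by ring
  have h5 : |d ^ 2 - (a ^ 2 - a * x + x ^ 2 / 4)| ≤ 100 * a ^ 3 := by
    have e1 : d ^ 2 - (a ^ 2 - a * x + x ^ 2 / 4) = (d - (x / 2 - a)) * (d + (x / 2 - a)) := by
      ring
    have b1 : |d - (x / 2 - a)| ≤ 5 * a ^ 2 := by
      have := abs_le.1 h2
      have p1 : a ^ 3 ≤ a ^ 2 * (1 / 8) := by nlinarith [sq_nonneg a]
      have p2 : x ^ 2 ≤ a ^ 2 := pow_le_pow_left₀ hx.le hxa 2
      have p3 : a * x ≤ a ^ 2 := by nlinarith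
      have p4 : 0 ≤ a * x := by positivity
      rw [abs_le]
      constructor <;> nlinarith
    have b2 : |d + (x / 2 - a)| ≤ 4 * a := by
      have := abs_le.1 h1
      rw [abs_le]
      constructor <;> linarith
    rw [e1, abs_mul]
    calc _ ≤ 5 * a ^ 2 * (4 * a) := by gcongr
      _ ≤ _ := by nlinarith [pow_pos ha0 3]
  rw [e]
  have e2 : (1 + d) ^ K - (1 + K * (x / 2 - a + x ^ 2 / 12 - a * x) +
      K * (K - 1) / 2 * (a ^ 2 - a * x + x ^ 2 / 4)) =
      ((1 + d) ^ K - 1 - K * d - K * (K - 1) / 2 * d ^ 2) +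
      K * (d - (x / 2 - a + x ^ 2 / 12 - a * x)) +
      K * (K - 1) / 2 * (d ^ 2 - (a ^ 2 - a * x + x ^ 2 / 4)) := by ring
  rw [e2]
  calc _ ≤ |(1 + d) ^ K - 1 - K * d - K * (K - 1) / 2 * d ^ 2| +
      |K| * |d - (x / 2 - a + x ^ 2 / 12 - a * x)| +
      |K * (K - 1) / 2| * |d ^ 2 - (a ^ 2 - a * x + x ^ 2 / 4)| := by
        rw [← abs_mul, ← abs_mul]
        exact abs_add_three _ _ _
    _ ≤ C * (8 * a ^ 3) + |K| * (10 * a ^ 3) + |K * (K - 1) / 2| * (100 * a ^ 3) := by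
        gcongr
        exact h3.trans (mul_le_mul_of_nonneg_left h4 hC)
    _ = _ := by ring

end Taylor

section Moments

lemma abs_mean_sub_sq_le {n x : ℝ} (hn : 1 ≤ n) (hx : 0 < x) (hnx : n * x ≤ 1 / 2) :
    |x * (n - (1 - exp (-(2 * n * x))) / (2 * sinh x)) - (n * x) ^ 2| ≤ 2 * (n * x) ^ 3 := by
  have hxa : x ≤ n * x := le_mul_of_one_le_left hx.le hn
  have hs := self_le_sinh_iff.2 hx.le
  have hs2 := sinh_le_add_cube hx.le (by linarith)
  have hs0 : 0 < sinh x := hx.trans_le hs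
  set h := x / sinh x with hh
  set q := (1 - exp (-(2 * n * x))) / 2 with hq
  have e : x * (n - (1 - exp (-(2 * n * x))) / (2 * sinh x)) = n * x - h * q := by
    rw [hh, hq]
    field_simp
  have ha0 : 0 < n * x := hx.trans_le hxa
  have hb := abs_exp_sub_quadratic_le (x := -(2 * n * x))
    (by rw [abs_neg, abs_of_pos (by linarith)]; linarith)
  rw [abs_neg, abs_of_pos (by linarith : 0 < 2 * n * x), abs_le] at hb
  have hex1 := add_one_le_exp (-(2 * n * x))
  have hex2 : exp (-(2 * n * x)) ≤ 1 := exp_le_one_iff.2 (by linarith)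
  rw [e]
  have hh1 : h ≤ 1 := (div_le_one hs0).2 hs
  have hh2 : 1 - x ^ 2 ≤ h := by
    rw [hh, le_div_iff₀ hs0]
    rcases le_total (1 - x ^ 2) 0 with h0 | h0
    · nlinarith
    · nlinarith [mul_le_mul_of_nonneg_left hs2 h0, pow_pos hx 5]
  have hxx : x ^ 2 ≤ (n * x) ^ 2 := pow_le_pow_left₀ hx.le hxa 2
  set a := n * x with ha
  have hqa : |q - (a - a ^ 2)| ≤ a ^ 3 := by
    have h2a : 2 * n * x = 2 * a := by rw [ha]; ring
    rw [h2a] at hb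
    rw [hq, h2a, abs_le]
    have := pow_pos ha0 3
    constructor <;> nlinarith [hb.1, hb.2]
  have hq0 : 0 ≤ q := by rw [hq]; linarith
  have hq1 : q ≤ a := by rw [hq, ha]; linarith
  have hhq : (1 - h) * q ≤ a ^ 3 := by
    calc (1 - h) * q ≤ a ^ 2 * a :=
          mul_le_mul (by linarith) hq1 hq0 (by positivity)
      _ = _ := by ring
  have hhq0 : 0 ≤ (1 - h) * q := mul_nonneg (by linarith) hq0
  rw [abs_le] at hqa ⊢
  constructor <;> nlinarith

lemma mean_div_sinh_sub_le {n x : ℝ} (hn : 1 ≤ n) (hx : 0 < x) (hnx : n * x ≤ 1 / 4) :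
    (n - (1 - exp (-(2 * n * x))) / (2 * sinh x)) / sinh x -
      (n - (1 - exp (-(2 * n * (2 * x)))) / (2 * sinh (2 * x))) / sinh (2 * x) ≤
      10 * n ^ 3 * x := by
  have hxn : x ≤ n * x := le_mul_of_one_le_left hx.le hn
  have h2x : 0 < 2 * x := by linarith
  have b1 := (abs_le.1 (abs_mean_sub_sq_le hn hx (by linarith))).2
  have b2 := (abs_le.1 (abs_mean_sub_sq_le hn h2x (by linarith))).1
  set F := n - (1 - exp (-(2 * n * x))) / (2 * sinh x)
  set G := n - (1 - exp (-(2 * n * (2 * x)))) / (2 * sinh (2 * x))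
  have hs := self_le_sinh_iff.2 hx.le
  have hs0 : 0 < sinh x := hx.trans_le hs
  have ht := self_le_sinh_iff.2 h2x.le
  have ht2 := sinh_le_add_cube h2x.le (by linarith)
  have ht0 : 0 < sinh (2 * x) := h2x.trans_le ht
  have hF : F / sinh x ≤ n ^ 2 + 2 * n ^ 3 * x := by
    rw [div_le_iff₀ hs0]
    have h1 : F ≤ (n ^ 2 + 2 * n ^ 3 * x) * x := by
      refine le_of_mul_le_mul_left ?_ hx
      nlinarith
    exact h1.trans (mul_le_mul_of_nonneg_left hs (by positivity))
  have hG : n ^ 2 - 4 * n ^ 3 * x - 4 * n ^ 2 * x ^ 2 ≤ G / sinh (2 * x) := by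
    have h1 : (n ^ 2 - 4 * n ^ 3 * x) * (2 * x) ≤ G := by
      refine le_of_mul_le_mul_left ?_ h2x
      nlinarith
    rw [le_div_iff₀ ht0]
    refine le_trans ?_ h1
    have p1 : 4 * n ^ 3 * x * (2 * x) ≤ 4 * n ^ 3 * x * sinh (2 * x) :=
      mul_le_mul_of_nonneg_left ht (by positivity)
    have p2 : n ^ 2 * (1 - 4 * x ^ 2) * sinh (2 * x) ≤ n ^ 2 * (2 * x) := by
      have h4 : 0 ≤ 1 - 4 * x ^ 2 := by nlinarith
      have h5 : (1 - 4 * x ^ 2) * sinh (2 * x) ≤ 2 * x := by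
        refine (mul_le_mul_of_nonneg_left ht2 h4).trans ?_
        nlinarith [pow_pos hx 5]
      nlinarith [sq_nonneg n]
    nlinarith
  have h6 : 4 * n ^ 2 * x ^ 2 ≤ 4 * n ^ 3 * x := by
    have : x * (n ^ 2 * x) ≤ n * (n ^ 2 * x) :=
      mul_le_mul_of_nonneg_right (by linarith) (by positivity)
    nlinarith
  linarith

variable {N : ℕ}

lemma mul_neg_logDeriv_eq (X : SOodd N) (x : ℝ) :
    x * -logDeriv (charPoly X) (exp (-x)) =
      exp x * (x / (exp x - 1) - N * x) + exp x * (x * fluct X x) := by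
  have h : exp x * exp (-x) = 1 := by rw [← exp_add]; simp
  rw [fluct]
  linear_combination (x * logDeriv (charPoly X) (exp (-x))) * h

lemma exp_le_two_of_le {x : ℝ} (hx : x ≤ 1 / 8) : exp x ≤ 2 := by
  refine (exp_le_exp.2 (hx.trans (by norm_num : (1 / 8 : ℝ) ≤ 1 / 2))).trans ?_
  have h := exp_bound' (x := 1 / 2) (by norm_num) (by norm_num) (n := 2) (by norm_num)
  norm_num [Finset.sum_range_succ, Nat.factorial] at h
  linarith

lemma mul_fluct_le (X : SOodd N) {x : ℝ} (hx : 0 < x) (hx8 : x ≤ 1 / 8) :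
    x * fluct X x ≤ 4 * N := by
  have h := mul_le_mul_of_nonneg_left (fluct_le X hx) hx.le
  refine h.trans ?_
  have hs2 := sinh_le_add_cube hx.le (by linarith)
  have hc : x ^ 2 / 2 ≤ cosh x - 1 := by
    have h1 := self_le_sinh_iff.2 (by positivity : 0 ≤ x / 2)
    have h2 := cosh_two_mul (x / 2)
    rw [mul_div_cancel₀ x two_ne_zero, cosh_sq] at h2
    nlinarith
  have hc0 : 0 < cosh x - 1 := lt_of_lt_of_le (by positivity) hc
  have hr : x * (sinh x / (cosh x - 1)) ≤ 4 := by
    rw [mul_div_assoc', div_le_iff₀ hc0]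
    have : sinh x ≤ 2 * x := by nlinarith [sq_nonneg x]
    nlinarith
  calc x * (N * (sinh x / (cosh x - 1))) = x * (sinh x / (cosh x - 1)) * N := by ring
    _ ≤ 4 * N := mul_le_mul_of_nonneg_right hr N.cast_nonneg

variable (μ : Measure (SOodd N)) [μ.IsHaarMeasure] [IsProbabilityMeasure μ]

lemma abs_integral_exp_mul_fluct_sub_le (hN : N ≠ 0) {x : ℝ} (hx : 0 < x) (hNx : N * x ≤ 1 / 8) :
    |∫ X, exp x * (x * fluct X x) ∂μ - (N * x) ^ 2| ≤ 8 * (N * x) ^ 3 := by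
  have hn : (1 : ℝ) ≤ N := by exact_mod_cast Nat.one_le_iff_ne_zero.2 hN
  have hxa : x ≤ N * x := le_mul_of_one_le_left hx.le hn
  rw [integral_const_mul, integral_const_mul, integral_fluct μ hN hx]
  have h := abs_mean_sub_sq_le hn hx (by linarith)
  set Z := x * ((N : ℝ) - (1 - exp (-(2 * N * x))) / (2 * sinh x))
  set a := N * x
  have ha0 : 0 < a := hx.trans_le hxa
  rw [abs_le] at h
  have hex := abs_le.1 (abs_exp_sub_quadratic_le (x := x) (by rw [abs_of_pos hx]; linarith))
  rw [abs_of_pos hx] at hex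
  have h1 : 0 ≤ exp x - 1 := by linarith [add_one_le_exp x]
  have h2 : exp x - 1 ≤ 2 * a := by
    have p2 : x ^ 2 ≤ x := by nlinarith
    have p3 : x ^ 3 ≤ x := by nlinarith
    nlinarith [hex.2]
  have h3 : a ^ 3 ≤ a ^ 2 * (1 / 8) := by nlinarith [sq_nonneg a]
  have hZ : |Z| ≤ 2 * a ^ 2 := by
    rw [abs_le]
    constructor <;> nlinarith [sq_nonneg a]
  have h4 : |(exp x - 1) * Z| ≤ 2 * a * (2 * a ^ 2) := by
    rw [abs_mul, abs_of_nonneg h1]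
    exact mul_le_mul h2 hZ (abs_nonneg _) (by positivity)
  rw [abs_le] at h4 ⊢
  have := pow_pos ha0 3
  constructor <;> nlinarith

lemma integral_exp_mul_fluct_sq_le (hN : N ≠ 0) {x : ℝ} (hx : 0 < x) (hNx : N * x ≤ 1 / 8) :
    ∫ X, (exp x * (x * fluct X x)) ^ 2 ∂μ ≤ 240 * N * (N * x) ^ 3 := by
  have hn : (1 : ℝ) ≤ N := by exact_mod_cast Nat.one_le_iff_ne_zero.2 hN
  have hxa : x ≤ N * x := le_mul_of_one_le_left hx.le hn
  have h2x : 0 < 2 * x := by linarith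
  have hc1 := continuous_fluct (N := N) hx
  have hc2 := continuous_fluct (N := N) h2x
  have hcosh : cosh x ≤ 2 := by
    rw [cosh_eq]
    have := exp_le_two_of_le (hxa.trans hNx)
    have : exp (-x) ≤ 1 := exp_le_one_iff.2 (by linarith)
    linarith
  have hV : ∫ X, fluct X x ^ 2 ∂μ ≤ 60 * N ^ 4 * x := by
    have hm := integral_mono (μ := μ) (hc1.pow 2).integrable_of_compactSpace
      (Continuous.integrable_of_compactSpace (by fun_prop)) fun X => fluct_sq_le X hx
    refine hm.trans ?_
    rw [integral_const_mul, integral_sub (hc1.div_const _).integrable_of_compactSpace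
      (hc2.div_const _).integrable_of_compactSpace, integral_div, integral_div,
      integral_fluct μ hN hx, integral_fluct μ hN h2x]
    have hb := mean_div_sinh_sub_le hn hx (by linarith)
    have hcc : 0 < cosh x := cosh_pos x
    calc _ ≤ 2 * N * (cosh x + 1) * (10 * N ^ 3 * x) :=
          mul_le_mul_of_nonneg_left hb (by positivity)
      _ ≤ 2 * N * (2 + 1) * (10 * N ^ 3 * x) := by gcongr
      _ = _ := by ring
  have hexp := exp_le_two_of_le (hxa.trans hNx)
  have hV0 : 0 ≤ ∫ X, fluct X x ^ 2 ∂μ := integral_nonneg fun X => sq_nonneg _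
  calc ∫ X, (exp x * (x * fluct X x)) ^ 2 ∂μ = (exp x * x) ^ 2 * ∫ X, fluct X x ^ 2 ∂μ := by
        rw [← integral_const_mul]
        exact integral_congr_ae (Eventually.of_forall fun X => by ring)
    _ ≤ (2 * x) ^ 2 * (60 * N ^ 4 * x) := by gcongr
    _ = _ := by ring

lemma neg_logDeriv_charPoly_pos (hN : N ≠ 0) {x : ℝ} (hx : 0 < x) (hNx : N * x ≤ 1 / 8)
    (X : SOodd N) : 0 < -logDeriv (charPoly X) (exp (-x)) := by
  have hn : (1 : ℝ) ≤ N := by exact_mod_cast Nat.one_le_iff_ne_zero.2 hN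
  have hxa : x ≤ N * x := le_mul_of_one_le_left hx.le hn
  have hy := (abs_le.1 (abs_edge_sub_one_le hx hxa hNx)).1
  have hU : 0 ≤ exp x * (x * fluct X x) := by
    have := fluct_nonneg X hx
    positivity
  have h := mul_neg_logDeriv_eq X x
  exact pos_of_mul_pos_right (by rw [h]; linarith) hx.le

/-- Expansion of the moments with an error of third order in `N * x`. -/
lemma exists_abs_moment_sub_le {K : ℝ} (hK : 0 < K) : ∃ C : ℝ, 0 < C ∧ ∀ (N : ℕ) (x : ℝ)
    (μ : Measure (SOodd N)) [μ.IsHaarMeasure] [IsProbabilityMeasure μ], N ≠ 0 → 0 < x →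
    N * x ≤ 1 / 8 →
    |x ^ K * (∫ X, (-logDeriv (charPoly X) (exp (-x))) ^ K ∂μ) -
      (1 + K * (x / 2 - N * x + x ^ 2 / 12 - N * x * x) +
        K * (K - 1) / 2 * ((N * x) ^ 2 - N * x * x + x ^ 2 / 4) + K * (N * x) ^ 2)| ≤
      C * ((N : ℝ) ^ (max (K - 2) 0 + 1) * (N * x) ^ 3) := by
  obtain ⟨C₁, hC₁, h₁⟩ := exists_abs_edge_rpow_sub_le K
  obtain ⟨C₂, hC₂, h₂⟩ := exists_abs_one_add_rpow_sub_one_le (K - 1)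
  set M := max (K - 2) 0 with hM
  have hM0 : 0 ≤ M := le_max_right _ _
  set D := |K| * |K - 1| * 2 ^ |K - 2| * 9 ^ M with hD
  have hD0 : 0 ≤ D := by positivity
  refine ⟨C₁ + K * (1 + C₂) * 10 + D * 240, by positivity, ?_⟩
  intro N x μ _ _ hN hx hNx
  have hn : (1 : ℝ) ≤ N := by exact_mod_cast Nat.one_le_iff_ne_zero.2 hN
  have hxa : x ≤ N * x := le_mul_of_one_le_left hx.le hn
  have ha0 : 0 < N * x := hx.trans_le hxa
  have hmean := abs_integral_exp_mul_fluct_sub_le μ hN hx hNx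
  have hsq := integral_exp_mul_fluct_sq_le μ hN hx hNx
  have hedge := abs_edge_sub_one_le hx hxa hNx
  have hmain := h₁ x (N * x) hx hxa hNx
  set y := exp x * (x / (exp x - 1) - N * x) with hy
  set U : SOodd N → ℝ := fun X => exp x * (x * fluct X x) with hU
  have hUc : Continuous U := by
    have := continuous_fluct (N := N) hx
    fun_prop
  have hU0 : ∀ X, 0 ≤ U X := fun X => by
    have := fluct_nonneg X hx
    positivity
  have hU8 : ∀ X, U X ≤ 8 * N := fun X => by
    have h1 := mul_fluct_le X hx (hxa.trans hNx)
    have h2 := exp_le_two_of_le (hxa.trans hNx)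
    calc U X ≤ 2 * (4 * N) := mul_le_mul h2 h1 (mul_nonneg hx.le (fluct_nonneg X hx)) two_pos.le
      _ = _ := by ring
  have hyl := abs_le.1 hedge
  have hy1 : 1 / 2 ≤ y := by linarith
  have hy2 : y ≤ 2 := by linarith
  have hmom : x ^ K * (∫ X, (-logDeriv (charPoly X) (exp (-x))) ^ K ∂μ) =
      ∫ X, (y + U X) ^ K ∂μ := by
    rw [← integral_const_mul]
    refine integral_congr_ae (Eventually.of_forall fun X => ?_)
    simp only
    rw [← mul_rpow hx.le (neg_logDeriv_charPoly_pos hN hx hNx X).le, mul_neg_logDeriv_eq]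
  have hYc : Continuous fun X => (y + U X) ^ K :=
    (by fun_prop : Continuous fun X => y + U X).rpow_const fun X => Or.inr hK.le
  set E := ∫ X, U X ∂μ with hE
  have hrem : |∫ X, (y + U X) ^ K ∂μ - y ^ K - K * y ^ (K - 1) * E| ≤
      D * 240 * ((N : ℝ) ^ (M + 1) * (N * x) ^ 3) := by
    have hlin : ∫ X, (y + U X) ^ K ∂μ - y ^ K - K * y ^ (K - 1) * E =
        ∫ X, ((y + U X) ^ K - y ^ K - K * y ^ (K - 1) * U X) ∂μ := by
      have i1 : Integrable (fun X => (y + U X) ^ K) μ := hYc.integrable_of_compactSpace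
      have i2 : Integrable (fun X => (y + U X) ^ K - y ^ K) μ := i1.sub (integrable_const _)
      have i3 : Integrable (fun X => K * y ^ (K - 1) * U X) μ :=
        (continuous_const.mul hUc).integrable_of_compactSpace
      rw [integral_sub i2 i3, integral_sub i1 (integrable_const _), integral_const_mul]
      simp [hE]
    have hpt : ∀ X, |(y + U X) ^ K - y ^ K - K * y ^ (K - 1) * U X| ≤
        D * (N : ℝ) ^ M * U X ^ 2 := by
      intro X
      refine (abs_add_rpow_sub_linear_le K hy1 hy2 (hU0 X)).trans ?_
      have h9 : (1 + U X) ^ M ≤ 9 ^ M * (N : ℝ) ^ M := by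
        rw [← mul_rpow (by norm_num) N.cast_nonneg]
        exact rpow_le_rpow (by linarith [hU0 X]) (by linarith [hU8 X]) hM0
      calc _ ≤ |K| * |K - 1| * 2 ^ |K - 2| * (9 ^ M * (N : ℝ) ^ M) * U X ^ 2 := by gcongr
        _ = _ := by rw [hD]; ring
    rw [hlin]
    calc _ ≤ ∫ X, |(y + U X) ^ K - y ^ K - K * y ^ (K - 1) * U X| ∂μ :=
          abs_integral_le_integral_abs
      _ ≤ ∫ X, D * (N : ℝ) ^ M * U X ^ 2 ∂μ := by
          refine integral_mono ?_ ?_ hpt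
          · exact ((hYc.sub continuous_const).sub
              (continuous_const.mul hUc)).abs.integrable_of_compactSpace
          · exact (continuous_const.mul (hUc.pow 2)).integrable_of_compactSpace
      _ = D * (N : ℝ) ^ M * ∫ X, U X ^ 2 ∂μ := integral_const_mul _ _
      _ ≤ D * (N : ℝ) ^ M * (240 * N * (N * x) ^ 3) :=
          mul_le_mul_of_nonneg_left hsq (by positivity)
      _ = _ := by
          rw [rpow_add_one (by positivity)]
          ring
  have hNM : 1 ≤ (N : ℝ) ^ (M + 1) := one_le_rpow hn (by linarith)
  have hpow := h₂ (y - 1) (by linarith)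
  rw [add_sub_cancel] at hpow
  set P := y ^ (K - 1)
  have hlinear : |P * E - (N * x) ^ 2| ≤ (1 + C₂) * 10 * (N * x) ^ 3 := by
    have ha2 : 0 ≤ (N * x) ^ 2 := sq_nonneg _
    have e : P * E - (N * x) ^ 2 =
        (P - 1) * (N * x) ^ 2 + (P - 1) * (E - (N * x) ^ 2) + (E - (N * x) ^ 2) := by ring
    have hP : |P - 1| ≤ C₂ * (2 * (N * x)) := hpow.trans (by gcongr)
    have hP' : |P - 1| ≤ C₂ := hP.trans (by nlinarith)
    rw [e]
    calc _ ≤ |P - 1| * (N * x) ^ 2 + |P - 1| * |E - (N * x) ^ 2| + |E - (N * x) ^ 2| := by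
          refine (abs_add_three _ _ _).trans (le_of_eq ?_)
          rw [abs_mul, abs_mul, abs_of_nonneg ha2]
      _ ≤ C₂ * (2 * (N * x)) * (N * x) ^ 2 + C₂ * (8 * (N * x) ^ 3) + 8 * (N * x) ^ 3 := by
          gcongr
      _ ≤ _ := by nlinarith [pow_pos ha0 3]
  rw [hmom]
  set T := 1 + K * (x / 2 - N * x + x ^ 2 / 12 - N * x * x) +
    K * (K - 1) / 2 * ((N * x) ^ 2 - N * x * x + x ^ 2 / 4)
  set J := ∫ X, (y + U X) ^ K ∂μ
  have e : J - (T + K * (N * x) ^ 2) = (J - y ^ K - K * P * E) + (y ^ K - T) +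
      K * (P * E - (N * x) ^ 2) := by ring
  have ha3 : (N * x) ^ 3 ≤ (N : ℝ) ^ (M + 1) * (N * x) ^ 3 :=
    le_mul_of_one_le_left (by positivity) hNM
  rw [e]
  calc _ ≤ |J - y ^ K - K * P * E| + |y ^ K - T| + K * |P * E - (N * x) ^ 2| := by
        refine (abs_add_three _ _ _).trans (le_of_eq ?_)
        rw [abs_mul, abs_of_pos hK]
    _ ≤ D * 240 * ((N : ℝ) ^ (M + 1) * (N * x) ^ 3) + C₁ * (N * x) ^ 3 +
        K * ((1 + C₂) * 10 * (N * x) ^ 3) := by gcongr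
    _ ≤ D * 240 * ((N : ℝ) ^ (M + 1) * (N * x) ^ 3) + C₁ * ((N : ℝ) ^ (M + 1) * (N * x) ^ 3) +
        K * ((1 + C₂) * 10 * ((N : ℝ) ^ (M + 1) * (N * x) ^ 3)) := by gcongr
    _ = _ := by ring

end Moments

/-- Refined asymptotics of the non-integer moments of the logarithmic derivative over
`SO(2N+1)`, with error term `O(N^{m+1} a⁴ + N^m a³)`. -/
theorem nonInteger_moments_logDeriv_SOodd_refined
    (K : ℝ) (hK : 0 < K)
    (m : ℤ) (hmodd : Odd m) (hm3 : 3 ≤ m) (hmK : ⌊K⌋ ≤ m)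
    (a : ℕ → ℝ) (hapos : ∀ N : ℕ, 1 ≤ N → 0 < a N)
    (halim : Tendsto a atTop (nhds 0))
    (μ : (N : ℕ) → Measure (SOodd N))
    (hμHaar : ∀ N : ℕ, (μ N).IsHaarMeasure)
    (hμProb : ∀ N : ℕ, IsProbabilityMeasure (μ N)) :
    ∃ C : ℝ, 0 < C ∧ ∃ N₀ : ℕ, ∀ N : ℕ, N₀ ≤ N →
      (∀ X : SOodd N, 0 < -(logDeriv (charPoly X) (Real.exp (-(a N) / N)))) ∧
      |(a N / N) ^ K *
            (∫ X, (-(logDeriv (charPoly X) (Real.exp (-(a N) / N)))) ^ K ∂(μ N)) -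
          (1 - K * a N + K * a N / (2 * N) + K * (K + 1) / 2 * a N ^ 2 -
            K * (K + 1) * a N ^ 2 / (2 * N) + a N ^ 2 / (N : ℝ) ^ 2 * K * (3 * K - 1) / 24)| ≤
        C * ((N : ℝ) ^ (m + 1) * a N ^ 4 + (N : ℝ) ^ m * a N ^ 3) := by
  obtain ⟨C, hC, hmom⟩ := exists_abs_moment_sub_le hK
  obtain ⟨N₁, hN₁⟩ := eventually_atTop.1
    (halim.eventually_le_const (by norm_num : (0 : ℝ) < 1 / 8))
  refine ⟨C, hC, max N₁ 1, fun N hN => ?_⟩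
  have hN1 : 1 ≤ N := (le_max_right _ _).trans hN
  have hN0 : N ≠ 0 := Nat.one_le_iff_ne_zero.1 hN1
  have hn : (1 : ℝ) ≤ N := by exact_mod_cast hN1
  have ha0 := hapos N hN1
  have hx : 0 < a N / N := div_pos ha0 (by linarith)
  have hNx : N * (a N / N) = a N := by field_simp
  have ha8 : N * (a N / N) ≤ 1 / 8 := by
    rw [hNx]
    exact hN₁ N ((le_max_left _ _).trans hN)
  have := hμHaar N
  have := hμProb N
  rw [neg_div]
  refine ⟨neg_logDeriv_charPoly_pos hN0 hx ha8, ?_⟩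
  have h := hmom N (a N / N) (μ N) hN0 hx ha8
  rw [hNx] at h
  have htarget : 1 - K * a N + K * a N / (2 * N) + K * (K + 1) / 2 * a N ^ 2 -
      K * (K + 1) * a N ^ 2 / (2 * N) + a N ^ 2 / (N : ℝ) ^ 2 * K * (3 * K - 1) / 24 =
      1 + K * (a N / N / 2 - a N + (a N / N) ^ 2 / 12 - a N * (a N / N)) +
        K * (K - 1) / 2 * (a N ^ 2 - a N * (a N / N) + (a N / N) ^ 2 / 4) + K * a N ^ 2 := by
    field_simp
    ring
  rw [htarget]
  refine h.trans (mul_le_mul_of_nonneg_left ?_ hC.le)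
  have hexp : max (K - 2) 0 + 1 ≤ (m : ℝ) := by
    have h3 : (3 : ℝ) ≤ m := by exact_mod_cast hm3
    have hfl : (⌊K⌋ : ℝ) ≤ m := by exact_mod_cast hmK
    have hlt := Int.lt_floor_add_one K
    rcases max_cases (K - 2) 0 with h | h <;> linarith
  have hle : (N : ℝ) ^ (max (K - 2) 0 + 1) ≤ (N : ℝ) ^ m := by
    rw [← rpow_intCast]
    exact rpow_le_rpow_of_exponent_le hn hexp
  calc (N : ℝ) ^ (max (K - 2) 0 + 1) * a N ^ 3 ≤ (N : ℝ) ^ m * a N ^ 3 := by gcongr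
    _ ≤ _ := le_add_of_nonneg_left (by positivity)
end
end

section
/- Let m ∈ ℕ and K ∈ ℝ with ⌊K⌋ ≤ m. Then for all real x with x ≥ −1/2, |(1+x)^K − Σ_{n=0}^{m} binom(K,n) x^n| ≤ C_{K,m} |x|^{m+1}, where C_{K,m} = |binom(K,m+1)| · 2^{m+1−K}. -/
open Real

noncomputable section

/-- The generalized binomial coefficient `binom(α, n) = (1/n!) ∏_{j=0}^{n-1} (α - j)`. -/
def genBinom (α : ℝ) (n : ℕ) : ℝ :=
  (1 / n.factorial) * ∏ j ∈ Finset.range n, (α - j)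

theorem iteratedDeriv_rpow_const (K t : ℝ) (n : ℕ) :
    iteratedDeriv n (fun y : ℝ ↦ y ^ K) t = n.factorial * genBinom K n * t ^ (K - n) := by
  rw [iteratedDeriv_eq_iterate, Real.iter_deriv_rpow_const, descPochhammer_eval_eq_prod_range,
    genBinom]
  field_simp

/-- Lagrange form of the remainder in the binomial expansion. -/
theorem exists_rpow_sub_binomial_sum_eq (m : ℕ) (K x : ℝ) (hx : -1 < x) (hx0 : x ≠ 0) :
    ∃ t ∈ Set.uIoo 1 (1 + x),
      (1 + x) ^ K - ∑ n ∈ Finset.range (m + 1), genBinom K n * x ^ n =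
        genBinom K (m + 1) * t ^ (K - (m + 1)) * x ^ (m + 1) := by
  have hne : (1 : ℝ) ≠ 1 + x := by simpa using hx0
  have hpos : ∀ t ∈ Set.uIcc 1 (1 + x), t ≠ 0 := fun t ht ↦
    ((lt_min one_pos (by linarith)).trans_le ht.1).ne'
  have hsmooth : ∀ (n : ℕ), ∀ t ∈ Set.uIcc 1 (1 + x),
      ContDiffAt ℝ n (fun y : ℝ ↦ y ^ K) t := fun n t ht ↦
    Real.contDiffAt_rpow_const_of_ne (hpos t ht)
  obtain ⟨t, ht, h⟩ := taylor_mean_remainder_lagrange_iteratedDeriv (n := m) hne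
    (fun t ht ↦ (by exact_mod_cast hsmooth (m + 1) t ht :
      ContDiffAt ℝ (m + 1) (fun y : ℝ ↦ y ^ K) t).contDiffWithinAt)
  refine ⟨t, ht, ?_⟩
  have hsum : taylorWithinEval (fun y : ℝ ↦ y ^ K) m (Set.uIcc 1 (1 + x)) 1 (1 + x) =
      ∑ n ∈ Finset.range (m + 1), genBinom K n * x ^ n := by
    rw [taylor_within_apply]
    refine Finset.sum_congr rfl fun n _ ↦ ?_
    rw [iteratedDerivWithin_eq_iteratedDeriv (uniqueDiffOn_uIcc hne)
      (hsmooth n 1 Set.left_mem_uIcc) Set.left_mem_uIcc, iteratedDeriv_rpow_const,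
      Real.one_rpow, add_sub_cancel_left, smul_eq_mul]
    field_simp
  rw [← hsum, h, iteratedDeriv_rpow_const, add_sub_cancel_left]
  push_cast
  field_simp

/-- Taylor-type approximation of `(1+x)^K` by its truncated binomial series, for `x ≥ -1/2`. -/
theorem abs_rpow_sub_binomial_sum_le
    (m : ℕ) (K : ℝ) (hKm : ⌊K⌋ ≤ (m : ℤ)) (x : ℝ) (hx : -(1 / 2) ≤ x) :
    |(1 + x) ^ K - ∑ n ∈ Finset.range (m + 1), genBinom K n * x ^ n| ≤
      |genBinom K (m + 1)| * 2 ^ ((m : ℝ) + 1 - K) * |x| ^ (m + 1) := by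
  rcases eq_or_ne x 0 with rfl | hx0
  · simp [Finset.sum_range_succ', genBinom]
  obtain ⟨t, ht, h⟩ := exists_rpow_sub_binomial_sum_eq m K x (by linarith) hx0
  have hK : K < m + 1 := by
    exact_mod_cast Int.floor_lt.mp (Int.lt_add_one_iff.mpr hKm)
  have ht2 : 1 / 2 ≤ t := (le_min (by norm_num) (by linarith)).trans ht.1.le
  have hpow : t ^ (K - (m + 1)) ≤ 2 ^ ((m : ℝ) + 1 - K) := by
    calc t ^ (K - (m + 1)) ≤ (1 / 2 : ℝ) ^ (K - (m + 1)) :=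
          Real.rpow_le_rpow_of_nonpos (by norm_num) ht2 (by linarith)
      _ = 2 ^ ((m : ℝ) + 1 - K) := by
          rw [one_div, Real.inv_rpow zero_le_two, ← Real.rpow_neg zero_le_two, neg_sub]
  rw [h, abs_mul, abs_mul, abs_pow, abs_of_nonneg (Real.rpow_nonneg (by linarith : 0 ≤ t) _)]
  gcongr
end
end
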